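/- arXiv:2009.10851 — 2 statements merged into one kernel-verified Lean document; each statement's English description precedes it below -/
import Mathlib

section
/- Let q ≥ 3 be a power of a prime p, e ≥ 3, a ∈ F_{q^e} nonzero with (−a)^ℓ ≠ 1, r ≥ 1, f(x) = x^r(x^{q−1} + a), and ℓ = q^{e−1} + ⋯ + q + 1. If the least nonnegative residue of r modulo ℓ equals h(ℓ − q^{e−1} − 1) + 1 for some integer h with 1 ≤ h ≤ q − 1, then f does not permute F_{q^e}. -/
open Finset

lemma aux_lucas (p : ℕ) (hp : p.Prime) (m : ℕ) : ∀ n k : ℕ,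
    p ∣ n.choose k ↔ p ∣ (n % p ^ m).choose (k % p ^ m) ∨ p ∣ (n / p ^ m).choose (k / p ^ m) := by
  have := Fact.mk hp
  have base : ∀ n k : ℕ, p ∣ n.choose k ↔ p ∣ (n % p).choose (k % p) ∨ p ∣ (n / p).choose (k / p) := by
    intro n k
    rw [← hp.dvd_mul]
    exact (Choose.choose_modEq_choose_mod_mul_choose_div_nat (n := n) (k := k) (p := p)).dvd_iff dvd_rfl
  induction m with
  | zero => intro n k; simp [Nat.mod_one, hp.one_lt.ne']
  | succ m ih =>
    intro n k
    rw [base n k, ih (n / p) (k / p), base (n % p ^ (m+1)) (k % p ^ (m+1))]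
    have e : p ^ (m+1) = p * p ^ m := pow_succ' p m
    rw [e, Nat.mod_mul_right_mod, Nat.mod_mul_right_mod, Nat.mod_mul_right_div_self,
      Nat.mod_mul_right_div_self, Nat.div_div_eq_div_mul, Nat.div_div_eq_div_mul, or_assoc]

lemma aux_full (p : ℕ) (hp : p.Prime) (n : ℕ) : ∀ J : ℕ, J < p ^ n →
    ¬ p ∣ (p ^ n - 1).choose J := by
  have key : ∀ J : ℕ, J < p ^ n → ((p ^ n - 1).choose J : ZMod p) = (-1) ^ J := by
    intro J
    induction J with
    | zero => simp
    | succ J ih =>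
      intro hJ
      have h1 := ih (by omega)
      have h2 : p ∣ (p ^ n).choose (J+1) :=
        hp.dvd_choose_pow (by omega) (by omega)
      have h3 : (p ^ n).choose (J+1) = (p ^ n - 1).choose J + (p ^ n - 1).choose (J+1) := by
        conv_lhs => rw [show p ^ n = (p ^ n - 1) + 1 by omega]
        exact Nat.choose_succ_succ _ _
      rw [h3, ← ZMod.natCast_eq_zero_iff] at h2
      push_cast at h2
      rw [h1] at h2
      rw [pow_succ]; linear_combination h2
  have := Fact.mk hp
  intro J hJ h
  rw [← ZMod.natCast_eq_zero_iff, key J hJ] at h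
  exact pow_ne_zero J (neg_ne_zero.mpr one_ne_zero) h

lemma aux_sub_two (p : ℕ) (hp : p.Prime) (m : ℕ) (hm : 0 < m) (h3 : 3 ≤ p ^ m) (i : ℕ) (hi : i < p ^ m) :
    p ∣ (p ^ m - 2).choose i ↔ p ∣ i + 1 := by
  have hpq : p ∣ p ^ m := dvd_pow_self p hm.ne'
  rcases Nat.lt_or_ge (i+1) (p^m) with h | h
  · have h1 := Nat.add_one_mul_choose_eq (p ^ m - 2) i
    have e : p ^ m - 2 + 1 = p ^ m - 1 := by omega
    rw [e] at h1
    have h2 := aux_full p hp m (i+1) h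
    have h4 : ¬ p ∣ p ^ m - 1 := by
      intro hd
      have := (Nat.dvd_sub hpq hd)
      rw [show p ^ m - (p ^ m - 1) = 1 by omega] at this
      exact hp.one_lt.ne' (Nat.dvd_one.mp this)
    have h5 : p ∣ (p ^ m - 1) * (p ^ m - 2).choose i ↔ p ∣ (p ^ m - 1).choose (i+1) * (i+1) := by
      rw [h1]
    rw [hp.dvd_mul, hp.dvd_mul] at h5
    tauto
  · have : i + 1 = p ^ m := by omega
    rw [this, Nat.choose_eq_zero_of_lt (by omega)]
    simp [hpq]

/-- nonvanishing criterion for a three-block exponent -/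
lemma aux_three (p : ℕ) (hp : p.Prime) (m k A B : ℕ) (hA : A < p ^ m) (hB : B < p ^ m) (j : ℕ)
    (hj : j < p ^ m * p ^ m * p ^ k) :
    p ∣ (A + B * p ^ m + p ^ m * p ^ m * (p ^ k - 1)).choose j ↔
      p ∣ A.choose (j % p ^ m) ∨ p ∣ B.choose (j / p ^ m % p ^ m) := by
  set q := p ^ m with hq
  have hq0 : 0 < q := by omega
  have e1 : (A + B * q + q * q * (p ^ k - 1)) = A + q * (B + q * (p ^ k - 1)) := by ring
  rw [aux_lucas p hp m, ← hq, e1]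
  rw [Nat.add_mul_mod_self_left, Nat.mod_eq_of_lt hA, Nat.add_mul_div_left _ _ hq0,
    Nat.div_eq_of_lt hA, zero_add]
  rw [aux_lucas p hp m (B + q * (p ^ k - 1)), ← hq, Nat.add_mul_mod_self_left, Nat.mod_eq_of_lt hB,
    Nat.add_mul_div_left _ _ hq0, Nat.div_eq_of_lt hB, zero_add]
  have := aux_full p hp k (j / q / q) (by
    rw [Nat.div_div_eq_div_mul]; exact Nat.div_lt_of_lt_mul hj)
  tauto

lemma aux_one (p : ℕ) (hp : p.Prime) (i : ℕ) : p ∣ (1).choose i ↔ ¬ i ≤ 1 := by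
  rcases i with _ | _ | i
  · simp [hp.one_lt.ne']
  · simp [hp.one_lt.ne']
  · rw [Nat.choose_eq_zero_of_lt (by omega)]; simp

lemma aux_hermite {F : Type*} [Field F] [Fintype F] (q e ℓ : ℕ) (hq : 2 ≤ q)
    (hF : Fintype.card F = q ^ e) (hℓ : (q - 1) * ℓ = q ^ e - 1) (a : F) (r : ℕ) (hr : 1 ≤ r)
    (hb : Function.Bijective (fun x : F => x ^ r * (x ^ (q - 1) + a))) (s : ℕ) (hs0 : 0 < s) (hs : s < ℓ) :
    ∑ j ∈ range ((q - 1) * s + 1),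
      (if ℓ ∣ r * s + j then (((q - 1) * s).choose j : F) * a ^ ((q - 1) * s - j) else 0) = 0 := by
  classical
  set N := (q - 1) * s with hN
  have hN0 : 0 < N := Nat.mul_pos (by omega) hs0
  have hNl : N < q ^ e - 1 := by rw [← hℓ]; exact Nat.mul_lt_mul_of_pos_left hs (by omega)
  have h1 : ∑ x : F, (x ^ r * (x ^ (q - 1) + a)) ^ N = 0 := by
    rw [hb.sum_comp (fun y : F => y ^ N)]
    exact FiniteField.sum_pow_lt_card_sub_one F N (by rw [hF]; exact hNl)
  have hpw : ∀ M : ℕ, 0 < M → ∑ x : F, x ^ M = if (q ^ e - 1) ∣ M then -1 else 0 := by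
    intro M hM
    have := FiniteField.sum_pow_units F M
    rw [hF] at this
    rw [← this, ← Finset.sum_subset (Finset.subset_univ (univ.erase (0:F)))]
    · symm
      refine Finset.sum_bij (fun (u : Fˣ) _ => (u : F)) ?_ ?_ ?_ ?_
      · intro u _; simp
      · intro u _ v _ h; exact Units.ext h
      · intro b hb; exact ⟨Units.mk0 b (by simpa using hb), by simp, rfl⟩
      · intro u _; simp
    · intro x _ hx
      have : x = 0 := by simpa using hx
      rw [this, zero_pow hM.ne']
  have h2 : ∑ x : F, (x ^ r * (x ^ (q - 1) + a)) ^ N =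
      ∑ j ∈ range (N+1), ((N.choose j : F) * a ^ (N - j)) * ∑ x : F, x ^ ((q - 1) * (r * s + j)) := by
    simp_rw [Finset.mul_sum]
    rw [Finset.sum_comm]
    refine Finset.sum_congr rfl fun x _ => ?_
    rw [mul_pow, add_pow, Finset.mul_sum]
    refine Finset.sum_congr rfl fun j _ => ?_
    have : x ^ ((q - 1) * (r * s + j)) = (x ^ r) ^ N * (x ^ (q-1)) ^ j := by
      rw [← pow_mul, ← pow_mul, ← pow_add, hN]; congr 1; ring
    rw [this]; ring
  rw [h2] at h1
  rw [← neg_eq_zero, ← Finset.sum_neg_distrib]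
  refine Eq.trans ?_ h1
  refine Finset.sum_congr rfl fun j _ => ?_
  rw [hpw _ (Nat.mul_pos (by omega) (Nat.lt_of_lt_of_le (Nat.mul_pos hr hs0) (Nat.le_add_right _ _)))]
  have hd : q ^ e - 1 ∣ (q - 1) * (r * s + j) ↔ ℓ ∣ r * s + j := by
    rw [← hℓ, Nat.mul_dvd_mul_iff_left (by omega)]
  simp only [hd]
  split_ifs <;> simp

lemma aux_single {F : Type*} [Field F] [Fintype F] (p : ℕ) [CharP F p] (N ℓ R : ℕ) (a : F)
    (ha : a ≠ 0)
    (hsum : ∑ j ∈ range (N + 1), (if ℓ ∣ R + j then (N.choose j : F) * a ^ (N - j) else 0) = 0)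
    (j₀ : ℕ) (h1 : ℓ ∣ R + j₀) (h2 : ¬ p ∣ N.choose j₀)
    (h3 : ∀ j, j ≤ N → ℓ ∣ R + j → ¬ p ∣ N.choose j → j = j₀) : False := by
  have hj : j₀ ≤ N := by
    by_contra h
    exact h2 (by rw [Nat.choose_eq_zero_of_lt (by omega)]; exact dvd_zero p)
  rw [Finset.sum_eq_single_of_mem j₀ (by simp; omega), if_pos h1] at hsum
  · refine mul_ne_zero ?_ (pow_ne_zero _ ha) hsum
    rwa [Ne, CharP.cast_eq_zero_iff F p]
  · intro j hjr hne
    split_ifs with hd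
    · have : p ∣ N.choose j := by
        by_contra hc
        exact hne (h3 j (by simp at hjr; omega) hd hc)
      rw [(CharP.cast_eq_zero_iff F p _).2 this, zero_mul]
    · rfl

lemma aux_digits (q j : ℕ) (x y M : ℤ) (hj : (j : ℤ) = x + y * q + q ^ 2 * M) :
    ∃ δ ε : ℤ, ((j % q : ℕ) : ℤ) = x - q * δ ∧ ((j / q % q : ℕ) : ℤ) = y + δ - q * ε := by
  have h1 : ((j % q : ℕ) : ℤ) + q * ((j / q : ℕ) : ℤ) = j := by exact_mod_cast Nat.mod_add_div j q
  have h2 : ((j / q % q : ℕ) : ℤ) + q * ((j / q / q : ℕ) : ℤ) = ((j / q : ℕ) : ℤ) := by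
    exact_mod_cast Nat.mod_add_div (j / q) q
  refine ⟨((j / q : ℕ) : ℤ) - y - q * M, ((j / q / q : ℕ) : ℤ) - M, ?_, ?_⟩
  · linear_combination h1 + hj
  · linear_combination h2

lemma aux_digits_eq (q j : ℕ) (x y M : ℤ) (hj : (j : ℤ) = x + y * q + q ^ 2 * M)
    (hx0 : 0 ≤ x) (hx : x < q) (hy0 : 0 ≤ y) (hy : y < q) :
    ((j % q : ℕ) : ℤ) = x ∧ ((j / q % q : ℕ) : ℤ) = y := by
  have hq : 0 < q := by omega
  obtain ⟨δ, ε, h1, h2⟩ := aux_digits q j x y M hj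
  have b1 : ((j % q : ℕ) : ℤ) < q := by exact_mod_cast Nat.mod_lt _ hq
  have b2 : ((j / q % q : ℕ) : ℤ) < q := by exact_mod_cast Nat.mod_lt _ hq
  have d0 : δ = 0 := by
    have : δ < 1 := by by_contra hc; nlinarith
    have : -1 < δ := by by_contra hc; nlinarith
    omega
  have e0 : ε = 0 := by
    have : ε < 1 := by by_contra hc; nlinarith
    have : -1 < ε := by by_contra hc; nlinarith
    omega
  subst d0 e0
  constructor <;> linarith

/-- bounds for the case `s = ℓ - 2` -/
lemma aux_bd1 (q h E l k j : ℤ) (hq : 3 ≤ q) (hh : 1 ≤ h) (hh2 : h ≤ q - 1) (hE : q ^ 2 ≤ E)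
    (hl : (q - 1) * l = q * E - 1) (hj : j = 2 - 2 * h * (E + 1) + k * l) (h0 : 0 ≤ j) (h1 : j < q * E) :
    (2 * h < q → 2 * h ≤ k ∧ k ≤ 2 * h + q - 2) ∧ (q < 2 * h → 2 * h - 1 ≤ k ∧ k ≤ 2 * h + q - 3) := by
  have hqE : 0 < q * E := by nlinarith
  have key : (q - 1) * j = (q - 1) * (2 - 2 * h) - 2 * h * (q - 1) * E + k * (q * E - 1) := by
    rw [hj, ← hl]; ring
  have k0 : 0 ≤ (q - 1) * j := by nlinarith
  have k1 : (q - 1) * j < (q - 1) * (q * E) := by nlinarith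
  have hlp : 0 < q * E - 1 := by nlinarith
  refine ⟨fun hc => ⟨?_, ?_⟩, fun hc => ⟨?_, ?_⟩⟩
  · by_contra hk
    have : k * (q * E - 1) ≤ (2 * h - 1) * (q * E - 1) := by
      apply mul_le_mul_of_nonneg_right _ hlp.le; omega
    nlinarith
  · by_contra hk
    have : (2 * h + q - 1) * (q * E - 1) ≤ k * (q * E - 1) := by
      apply mul_le_mul_of_nonneg_right _ hlp.le; omega
    have : 2 * h * q ^ 2 ≤ 2 * h * E := by nlinarith
    nlinarith
  · by_contra hk
    have : k * (q * E - 1) ≤ (2 * h - 2) * (q * E - 1) := by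
      apply mul_le_mul_of_nonneg_right _ hlp.le; omega
    have : (2 * q - 2 * h) * q ^ 2 ≤ (2 * q - 2 * h) * E := by nlinarith
    nlinarith
  · by_contra hk
    have : (2 * h + q - 2) * (q * E - 1) ≤ k * (q * E - 1) := by
      apply mul_le_mul_of_nonneg_right _ hlp.le; omega
    have : (2 * h - q) * q ^ 2 ≤ (2 * h - q) * E := by nlinarith
    nlinarith

lemma aux_ex1 (q h E l k j : ℤ) (hq : 3 ≤ q) (hh : 1 ≤ h) (hh2 : h ≤ q - 1) (hE : q ^ 2 ≤ E)
    (hl : (q - 1) * l = q * E - 1) (hj : j = 2 - 2 * h * (E + 1) + k * l)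
    (hk : (2 * h < q ∧ k = 2 * h + q - 2) ∨ (q < 2 * h ∧ k = 2 * h - 1)) : 0 ≤ j ∧ j < q * E := by
  have key : (q - 1) * j = (q - 1) * (2 - 2 * h) - 2 * h * (q - 1) * E + k * (q * E - 1) := by
    rw [hj, ← hl]; ring
  suffices H : 0 ≤ (q - 1) * j ∧ (q - 1) * j < (q - 1) * (q * E) by
    constructor
    · by_contra hc; nlinarith [H.1]
    · by_contra hc; nlinarith [H.2]
  rw [key]
  rcases hk with ⟨hc, rfl⟩ | ⟨hc, rfl⟩
  · constructor
    · have hE0 : 0 ≤ E := by nlinarith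
      have e1 : 0 ≤ (q ^ 2 - 2 * q) * E := mul_nonneg (by nlinarith) hE0
      have e2 : 2 * h * q ^ 2 ≤ 2 * h * E := by nlinarith
      have e3 : 2 * h * q ≤ 2 * h * q ^ 2 := by nlinarith
      nlinarith
    · have : (q - 2 * h) * q ^ 2 ≤ (q - 2 * h) * E := by nlinarith
      nlinarith
  · constructor
    · have e1 : (2 * h - q) * q ^ 2 ≤ (2 * h - q) * E := by nlinarith
      have e2 : 0 ≤ (2 * h - q - 1) * (q ^ 2 - q) := mul_nonneg (by omega) (by nlinarith)
      nlinarith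
    · have e1 : 0 ≤ (q ^ 2 - 2 * h) * E := mul_nonneg (by nlinarith) (by nlinarith)
      have e2 : 0 ≤ q * (h - 1) := mul_nonneg (by omega) (by omega)
      nlinarith

/-- bounds for the case `s = ℓ - (q - 1)` -/
lemma aux_bd2 (q h E l t j : ℤ) (hq : 3 ≤ q) (hh : 1 ≤ h) (hh2 : h ≤ q - 1) (hE : q ^ 2 ≤ E)
    (hl : (q - 1) * l = q * E - 1) (hj : j = q - 1 - h * (q - E) + (t + 1) * l) (h0 : 0 ≤ j)
    (h1 : j < q * E) : - h ≤ t ∧ t ≤ q - 1 - h := by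
  have hqE : 0 < q * E := by nlinarith
  have key : (q - 1) * j = (q - 1) * (q - 1 - h * q) + h * (q - 1) * E + (t + 1) * (q * E - 1) := by
    rw [hj, ← hl]; ring
  have k0 : 0 ≤ (q - 1) * j := by nlinarith
  have k1 : (q - 1) * j < (q - 1) * (q * E) := by nlinarith
  have hlp : 0 < q * E - 1 := by nlinarith
  refine ⟨?_, ?_⟩
  · by_contra hk
    have : (t + 1) * (q * E - 1) ≤ (- h) * (q * E - 1) := by
      apply mul_le_mul_of_nonneg_right _ hlp.le; omega
    have : h * q ^ 2 ≤ h * E := by nlinarith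
    nlinarith
  · by_contra hk
    have : (q + 1 - h) * (q * E - 1) ≤ (t + 1) * (q * E - 1) := by
      apply mul_le_mul_of_nonneg_right _ hlp.le; omega
    have : (2 * q - h) * q ^ 2 ≤ (2 * q - h) * E := by nlinarith
    nlinarith

lemma aux_ex2 (q h E l t j : ℤ) (hq : 3 ≤ q) (hh : 1 ≤ h) (hh2 : h ≤ q - 1) (hE : q ^ 2 ≤ E)
    (hl : (q - 1) * l = q * E - 1) (hj : j = q - 1 - h * (q - E) + (t + 1) * l)
    (ht : (1 - h ≤ t ∧ t ≤ q - 2 - h) ∨ (t = - h ∧ 2 * h = q)) : 0 ≤ j ∧ j < q * E := by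
  have hqE : 0 < q * E := by nlinarith
  have hlp : 0 < q * E - 1 := by nlinarith
  have key : (q - 1) * j = (q - 1) * (q - 1 - h * q) + h * (q - 1) * E + (t + 1) * (q * E - 1) := by
    rw [hj, ← hl]; ring
  suffices H : 0 ≤ (q - 1) * j ∧ (q - 1) * j < (q - 1) * (q * E) by
    constructor
    · by_contra hc; nlinarith [H.1]
    · by_contra hc; nlinarith [H.2]
  rw [key]
  rcases ht with ⟨ha, hb⟩ | ⟨rfl, hb⟩
  · constructor
    · have : (2 - h) * (q * E - 1) ≤ (t + 1) * (q * E - 1) := by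
        apply mul_le_mul_of_nonneg_right _ hlp.le; omega
      have : (2 * q - h) * q ^ 2 ≤ (2 * q - h) * E := by nlinarith
      nlinarith
    · have : (t + 1) * (q * E - 1) ≤ (q - 1 - h) * (q * E - 1) := by
        apply mul_le_mul_of_nonneg_right _ hlp.le; omega
      have : h * q ^ 2 ≤ h * E := by nlinarith
      nlinarith
  · subst hb
    constructor
    · have : h * (2 * h) ^ 2 ≤ h * E := by nlinarith
      nlinarith
    · have : h * (2 * h) ^ 2 ≤ h * E := by nlinarith
      nlinarith

lemma aux_quot (q δ c : ℤ) (hq : 0 < q) (h1 : q * (c - 1) < q * δ) (h2 : q * δ < q * (c + 1)) : δ = c := by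
  have a1 := lt_of_mul_lt_mul_left h1 hq.le
  have a2 := lt_of_mul_lt_mul_left h2 hq.le
  omega

set_option maxHeartbeats 1000000 in
lemma aux_case1 {F : Type*} [Field F] [Fintype F] (p m q e c : ℕ) (hp : p.Prime) (hm : 0 < m) (hq : q = p ^ m)
    (hq3 : 3 ≤ q) (hec : e = c + 3) [CharP F p] (hF : Fintype.card F = q ^ e)
    (a : F) (ha : a ≠ 0) (r : ℕ) (hr : 1 ≤ r) (ℓ G : ℕ) (hℓG : ℓ = 1 + q + q ^ 2 * G)
    (hℓ : (q - 1) * ℓ = q ^ e - 1)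
    (h : ℕ) (hh1 : 1 ≤ h) (hh2 : h ≤ q - 1)
    (hres : ∃ w : ℤ, (r : ℤ) = 1 - h * (q ^ (e - 1) + 1) + w * ℓ)
    (hb : Function.Bijective (fun x : F => x ^ r * (x ^ (q - 1) + a))) : p ∣ 2 * h := by
  by_contra hph
  have hl3 : q ≤ ℓ := by rw [hℓG]; omega
  have hsum := aux_hermite q e ℓ (by omega) hF hℓ a r hr hb (ℓ - 2) (by omega) (by omega)
  obtain ⟨w, hw⟩ := hres
  set E : ℕ := q ^ (e - 1) with hEdef
  have hEZ : (E : ℤ) = (q : ℤ) ^ (e - 1) := by rw [hEdef]; push_cast; rfl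
  clear_value E
  have hEq : E = q ^ 2 * q ^ c := by rw [hEdef, ← pow_add]; congr 1; omega
  have hE2 : q ^ 2 ≤ E := by rw [hEq]; exact Nat.le_mul_of_pos_right _ (by positivity)
  have hqe : q ^ e = q * E := by rw [hEdef, ← pow_succ']; congr 1; omega
  have hlZ : ((q : ℤ) - 1) * ℓ = q * E - 1 := by
    have : 1 ≤ q * E := by nlinarith
    rw [hqe] at hℓ
    zify [show 1 ≤ q by omega, this] at hℓ
    exact hℓ
  have hE2Z : (q : ℤ) ^ 2 ≤ E := by exact_mod_cast hE2
  have hqn : q * E = p ^ m * p ^ m * p ^ (m * (c + 1)) := by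
    rw [hEq, pow_mul, ← hq]; ring
  have hN : (q - 1) * (ℓ - 2) = 1 + (p ^ m - 2) * p ^ m + p ^ m * p ^ m * (p ^ (m * (c + 1)) - 1) := by
    have h1 : 1 ≤ p ^ (m * (c + 1)) := Nat.one_le_pow _ _ hp.pos
    rw [← hq]
    have h2 : q * E = q * q * p ^ (m * (c + 1)) := by rw [hqn, ← hq]
    zify at h2
    zify [show 1 ≤ q by omega, show 2 ≤ q by omega, show 2 ≤ ℓ by omega, h1]
    push_cast at h2
    linear_combination hlZ + h2
  -- criterion
  have crit : ∀ j : ℕ, j < q * E → (¬ p ∣ ((q - 1) * (ℓ - 2)).choose j ↔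
      (j % q ≤ 1 ∧ ¬ p ∣ j / q % q + 1)) := by
    intro j hj
    rw [hN, aux_three p hp m _ 1 (p ^ m - 2) (by omega) (by omega) j (by rw [← hqn]; exact hj),
      aux_one p hp, aux_sub_two p hp m hm (by omega) _ (Nat.mod_lt _ (by omega)), ← hq]
    tauto
  have hdv : ∀ j : ℕ, (ℓ ∣ r * (ℓ - 2) + j ↔ ∃ k : ℤ, (j : ℤ) = 2 - 2 * h * (E + 1) + k * ℓ) := by
    intro j
    rw [← Int.natCast_dvd_natCast]
    push_cast [show 2 ≤ ℓ by omega]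
    rw [← hEZ] at hw
    constructor
    · rintro ⟨k, hk⟩
      exact ⟨k - r + 2 * w, by linear_combination hk + 2 * hw⟩
    · rintro ⟨k, hk⟩
      exact ⟨k + r - 2 * w, by linear_combination hk - 2 * hw⟩
  have hform : ∀ (j : ℕ) (k : ℤ), (j : ℤ) = 2 - 2 * h * (E + 1) + k * ℓ →
      (j : ℤ) = (2 - 2 * h + k) + k * q + q ^ 2 * (- 2 * h * q ^ c + k * G) := by
    intro j k hj
    rw [hj, hℓG, hEq]; push_cast; ring
  have hq2h : (2 * h : ℤ) ≠ q := by
    intro hc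
    apply hph
    have : 2 * h = q := by exact_mod_cast hc
    rw [this, hq]; exact dvd_pow_self p hm.ne'
  have hex : ∃ k : ℤ, (2 * (h:ℤ) < q ∧ k = 2 * h + q - 2) ∨ ((q:ℤ) < 2 * h ∧ k = 2 * h - 1) := by
    rcases lt_or_gt_of_ne hq2h with hc | hc
    · exact ⟨_, Or.inl ⟨hc, rfl⟩⟩
    · exact ⟨_, Or.inr ⟨hc, rfl⟩⟩
  obtain ⟨k, hk⟩ := hex
  obtain ⟨hb0, hb1⟩ := aux_ex1 q h E ℓ k _ (by omega) (by omega) (by omega) hE2Z hlZ rfl hk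
  obtain ⟨j₀, hj₀⟩ := Int.eq_ofNat_of_zero_le hb0
  rw [hj₀] at hb1
  have hj₀q : j₀ < q * E := by exact_mod_cast hb1
  refine aux_single p _ ℓ _ a ha hsum j₀ ((hdv j₀).2 ⟨k, hj₀.symm⟩) ?_ ?_
  · rw [crit j₀ hj₀q]
    have hf := hform j₀ k hj₀.symm
    rcases hk with ⟨hc, hk⟩ | ⟨hc, hk⟩
    · obtain ⟨d1, d2⟩ := aux_digits_eq q j₀ 0 (2 * h - 1) (1 + (- 2 * h * q ^ c + k * G))
        (by rw [hf]; subst hk; ring) le_rfl (by omega) (by omega) (by omega)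
      refine ⟨by omega, ?_⟩
      rwa [show j₀ / q % q + 1 = 2 * h by omega]
    · obtain ⟨d1, d2⟩ := aux_digits_eq q j₀ 1 (2 * h - 1 - q) (1 + (- 2 * h * q ^ c + k * G))
        (by rw [hf]; subst hk; ring) (by omega) (by omega) (by omega) (by omega)
      refine ⟨by omega, ?_⟩
      intro hd
      apply hph
      rw [show 2 * h = (j₀ / q % q + 1) + q by omega]
      exact dvd_add hd (by rw [hq]; exact dvd_pow_self p hm.ne')
  · intro j hjN hjd hjc
    have hjq : j < q * E := by
      have : (q - 1) * (ℓ - 2) ≤ (q - 1) * ℓ := Nat.mul_le_mul_left _ (by omega)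
      have : 0 < q * E := by nlinarith
      rw [hℓ, hqe] at *
      omega
    rw [crit j hjq] at hjc
    obtain ⟨k', hk'⟩ := (hdv j).1 hjd
    obtain ⟨bl, bg⟩ := aux_bd1 q h E ℓ k' j (by omega) (by omega) (by omega) hE2Z hlZ hk' (by omega)
      (by exact_mod_cast hjq)
    obtain ⟨δ, ε, d1, d2⟩ := aux_digits q j _ _ _ (hform j k' hk')
    have hm1 : ((j % q : ℕ) : ℤ) ≤ 1 := by exact_mod_cast hjc.1
    have hm0 : (0 : ℤ) ≤ ((j % q : ℕ) : ℤ) := by omega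
    have : k' = k := by
      rcases hk with ⟨hc, hk⟩ | ⟨hc, hk⟩
      · have b := bl hc
        have hδ : δ = 1 := aux_quot q δ 1 (by omega) (by linarith) (by linarith)
        subst hδ; omega
      · have b := bg hc
        have hδ : δ = 0 := aux_quot q δ 0 (by omega) (by linarith) (by linarith)
        subst hδ; omega
    subst this
    have : (j : ℤ) = j₀ := by rw [hk', hj₀]
    exact_mod_cast this

lemma aux_double {F : Type*} [Field F] [Fintype F] [CharP F 2] (N ℓ R : ℕ) (a : F)
    (hsum : ∑ j ∈ range (N + 1), (if ℓ ∣ R + j then (N.choose j : F) * a ^ (N - j) else 0) = 0)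
    (j₀ j₁ : ℕ) (hne : j₀ ≠ j₁) (h1 : ℓ ∣ R + j₀) (h2 : ¬ 2 ∣ N.choose j₀)
    (h1' : ℓ ∣ R + j₁) (h2' : ¬ 2 ∣ N.choose j₁)
    (h3 : ∀ j, j ≤ N → ℓ ∣ R + j → ¬ 2 ∣ N.choose j → j = j₀ ∨ j = j₁) :
    j₀ ≤ N ∧ j₁ ≤ N ∧ a ^ (N - j₀) = a ^ (N - j₁) := by
  have hle : ∀ j, ¬ 2 ∣ N.choose j → j ≤ N := by
    intro j hj
    by_contra h
    exact hj (by rw [Nat.choose_eq_zero_of_lt (by omega)]; exact dvd_zero 2)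
  have hone : ∀ j, ¬ 2 ∣ N.choose j → (N.choose j : F) = 1 := by
    intro j hj
    have hd : N.choose j = 2 * (N.choose j / 2) + 1 := by omega
    rw [hd]
    push_cast
    rw [show (2 : F) = 0 from CharTwo.two_eq_zero]; ring
  refine ⟨hle _ h2, hle _ h2', ?_⟩
  have hj0 := hle _ h2
  have hj1 := hle _ h2'
  rw [Finset.sum_eq_add_of_mem j₀ j₁ (by simp; omega) (by simp; omega) hne, if_pos h1, if_pos h1',
    hone _ h2, hone _ h2', one_mul, one_mul] at hsum
  · rw [CharTwo.add_eq_zero] at hsum; exact hsum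
  · intro j hjr hn
    split_ifs with hd
    · have : 2 ∣ N.choose j := by
        by_contra hc
        rcases h3 j (by simp at hjr; omega) hd hc with h | h
        · exact hn.1 h
        · exact hn.2 h
      rw [(CharP.cast_eq_zero_iff F 2 _).2 this, zero_mul]
    · rfl

set_option maxHeartbeats 1000000 in
lemma aux_case2 {F : Type*} [Field F] [Fintype F] (p m q e c : ℕ) (hp : p.Prime) (hm : 0 < m) (hq : q = p ^ m)
    (hq3 : 3 ≤ q) (hec : e = c + 3) [CharP F p] (hF : Fintype.card F = q ^ e)
    (a : F) (ha : a ≠ 0) (r : ℕ) (hr : 1 ≤ r) (ℓ G : ℕ) (hℓG : ℓ = 1 + q + q ^ 2 * G)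
    (hℓ : (q - 1) * ℓ = q ^ e - 1) (hA : (-a) ^ ℓ ≠ 1)
    (h : ℕ) (hh1 : 1 ≤ h) (hh2 : h ≤ q - 1)
    (hres : ∃ w : ℤ, (r : ℤ) = 1 - h * (q ^ (e - 1) + 1) + w * ℓ)
    (hb : Function.Bijective (fun x : F => x ^ r * (x ^ (q - 1) + a))) : ¬ p ∣ 2 * h := by
  intro hph
  have hpq : p ∣ q := by rw [hq]; exact dvd_pow_self p hm.ne'
  have hl3 : q < ℓ := by rw [hℓG]; omega
  have hsum := aux_hermite q e ℓ (by omega) hF hℓ a r hr hb (ℓ - (q - 1)) (by omega) (by omega)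
  obtain ⟨w, hw⟩ := hres
  set E : ℕ := q ^ (e - 1) with hEdef
  have hEZ : (E : ℤ) = (q : ℤ) ^ (e - 1) := by rw [hEdef]; push_cast; rfl
  clear_value E
  have hEq : E = q ^ 2 * q ^ c := by rw [hEdef, ← pow_add]; congr 1; omega
  have hE2 : q ^ 2 ≤ E := by rw [hEq]; exact Nat.le_mul_of_pos_right _ (by positivity)
  have hqe : q ^ e = q * E := by rw [hEdef, ← pow_succ']; congr 1; omega
  have hlZ : ((q : ℤ) - 1) * ℓ = q * E - 1 := by
    have : 1 ≤ q * E := by nlinarith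
    rw [hqe] at hℓ
    zify [show 1 ≤ q by omega, this] at hℓ
    exact hℓ
  have hE2Z : (q : ℤ) ^ 2 ≤ E := by exact_mod_cast hE2
  have hqn : q * E = p ^ m * p ^ m * p ^ (m * (c + 1)) := by
    rw [hEq, pow_mul, ← hq]; ring
  have hsZ : ((ℓ - (q - 1) : ℕ) : ℤ) = ℓ - (q - 1) := by omega
  set N := (q - 1) * (ℓ - (q - 1)) with hNdef
  have hNq : N < q * E := by
    have : (q - 1) * (ℓ - (q - 1)) ≤ (q - 1) * ℓ := Nat.mul_le_mul_left _ (by omega)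
    have : 0 < q * E := by nlinarith
    rw [hℓ, hqe] at *
    omega
  have hN : N = (p ^ m - 2) + 1 * p ^ m + p ^ m * p ^ m * (p ^ (m * (c + 1)) - 1) := by
    have h1 : 1 ≤ p ^ (m * (c + 1)) := Nat.one_le_pow _ _ hp.pos
    rw [← hq, hNdef]
    have h2 : q * E = q * q * p ^ (m * (c + 1)) := by rw [hqn, ← hq]
    zify at h2
    zify [show 1 ≤ q by omega, show 2 ≤ q by omega, h1]
    rw [hsZ]
    push_cast at h2
    linear_combination hlZ + h2
  clear_value N
  have crit : ∀ j : ℕ, j < q * E → (¬ p ∣ N.choose j ↔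
      (j / q % q ≤ 1 ∧ ¬ p ∣ j % q + 1)) := by
    intro j hj
    rw [hN, aux_three p hp m _ (p ^ m - 2) 1 (by omega) (by omega) j (by rw [← hqn]; exact hj),
      aux_one p hp, aux_sub_two p hp m hm (by omega) _ (Nat.mod_lt _ (by omega)), ← hq]
    tauto
  have hdv : ∀ j : ℕ, (ℓ ∣ r * (ℓ - (q - 1)) + j ↔
      ∃ t : ℤ, (j : ℤ) = q - 1 - h * (q - E) + (t + 1) * ℓ) := by
    intro j
    rw [← Int.natCast_dvd_natCast, Nat.cast_add, Nat.cast_mul, hsZ]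
    rw [← hEZ] at hw
    constructor
    · rintro ⟨k, hk⟩
      exact ⟨k - r + (q - 1) * w - h * (q - 1) - 1, by linear_combination hk + ((q : ℤ) - 1) * hw + h * hlZ⟩
    · rintro ⟨k, hk⟩
      exact ⟨k + r - (q - 1) * w + h * (q - 1) + 1, by linear_combination hk - ((q : ℤ) - 1) * hw - h * hlZ⟩
  have hform : ∀ (j : ℕ) (t : ℤ), (j : ℤ) = q - 1 - h * (q - E) + (t + 1) * ℓ →
      (j : ℤ) = t + (t + 2 - h) * q + q ^ 2 * (h * q ^ c + (t + 1) * G) := by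
    intro j t hj
    rw [hj, hℓG, hEq]; push_cast; ring
  -- existence
  have hex : ∀ t : ℤ, ((1 - (h:ℤ) ≤ t ∧ t ≤ q - 2 - h) ∨ (t = - h ∧ 2 * (h:ℤ) = q)) → ∃ j : ℕ,
      j < q * E ∧ ℓ ∣ r * (ℓ - (q - 1)) + j ∧ (j : ℤ) = q - 1 - h * (q - E) + (t + 1) * ℓ := by
    intro t ht
    obtain ⟨hb0, hb1⟩ := aux_ex2 q h E ℓ t _ (by omega) (by omega) (by omega) hE2Z hlZ rfl ht
    obtain ⟨j₀, hj₀⟩ := Int.eq_ofNat_of_zero_le hb0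
    rw [hj₀] at hb1
    exact ⟨j₀, by exact_mod_cast hb1, (hdv j₀).2 ⟨t, hj₀.symm⟩, hj₀.symm⟩
  -- analysis of the surviving terms
  have huniq : ∀ j : ℕ, j ≤ N → ℓ ∣ r * (ℓ - (q - 1)) + j → ¬ p ∣ N.choose j →
      ∃ t : ℤ, (j : ℤ) = q - 1 - h * (q - E) + (t + 1) * ℓ ∧ - (h : ℤ) ≤ t ∧ t ≤ q - 1 - h ∧
        ((t = h - 2 ∧ ¬ p ∣ h - 1) ∨ (t = h - 1 ∧ ¬ p ∣ h) ∨ (t = h - 1 - q ∧ ¬ p ∣ h) ∨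
          (t = h - q ∧ ¬ p ∣ h + 1)) := by
    intro j hjN hjd hjc
    have hjq : j < q * E := lt_of_le_of_lt hjN hNq
    rw [crit j hjq] at hjc
    obtain ⟨t, ht⟩ := (hdv j).1 hjd
    obtain ⟨b1, b2⟩ := aux_bd2 q h E ℓ t j (by omega) (by omega) (by omega) hE2Z hlZ ht (by omega)
      (by exact_mod_cast hjq)
    refine ⟨t, ht, b1, b2, ?_⟩
    obtain ⟨δ, ε, d1, d2⟩ := aux_digits q j _ _ _ (hform j t ht)
    obtain ⟨hj1, hj2⟩ := hjc
    have hu : j % q < q := Nat.mod_lt _ (by omega)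
    generalize j % q = u at *
    generalize j / q % q = v at *
    have hhq : (h : ℤ) ≤ q - 1 := by omega
    rcases le_or_gt 0 t with ht0 | ht0
    · have hδ : δ = 0 := aux_quot q δ 0 (by omega) (by linarith) (by linarith)
      subst hδ
      have hε : ε = 0 := aux_quot q ε 0 (by omega) (by linarith) (by linarith)
      subst hε
      have hv : v = 0 ∨ v = 1 := by omega
      rcases hv with rfl | rfl
      · left
        refine ⟨by push_cast at d2; linarith, ?_⟩
        rwa [show h - 1 = u + 1 by push_cast at d2; omega]
      · right; left
        refine ⟨by push_cast at d2; linarith, ?_⟩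
        rwa [show h = u + 1 by push_cast at d2; omega]
    · have hδ : δ = -1 := aux_quot q δ (-1) (by omega) (by linarith) (by linarith)
      subst hδ
      have hε : ε = -1 := by
        have : ε ≠ 0 := by rintro rfl; omega
        have : ε < 1 := by
          have : (q:ℤ) * ε < q * 1 := by linarith
          exact lt_of_mul_lt_mul_left this (by omega)
        have : -2 < ε := by
          have : (q:ℤ) * (-2) < q * ε := by linarith
          exact lt_of_mul_lt_mul_left this (by omega)
        omega
      subst hε
      have hv : v = 0 ∨ v = 1 := by omega
      rcases hv with rfl | rfl
      · right; right; left
        refine ⟨by push_cast at d2; linarith, ?_⟩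
        rwa [show h = u + 1 by push_cast at d2; omega]
      · right; right; right
        refine ⟨by push_cast at d2; linarith, ?_⟩
        rwa [show h + 1 = u + 1 by push_cast at d2; omega]
  -- nonvanishing of surviving terms
  have hnvP : ∀ (j : ℕ) (t : ℤ), j < q * E → (j : ℤ) = q - 1 - h * (q - E) + (t + 1) * ℓ → 0 ≤ t → t < q →
      (t = h - 2 ∨ t = h - 1) → ¬ (p : ℤ) ∣ t + 1 → ¬ p ∣ N.choose j := by
    intro j t hj hjt t0 t1 htt hpt
    rw [crit j hj]
    obtain ⟨d1, d2⟩ := aux_digits_eq q j t (t + 2 - h) _ (hform j t hjt) t0 t1 (by omega) (by omega)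
    refine ⟨by omega, ?_⟩
    rw [← Int.natCast_dvd_natCast, Nat.cast_add, d1]; exact_mod_cast hpt
  have hnvN : ∀ (j : ℕ) (t : ℤ), j < q * E → (j : ℤ) = q - 1 - h * (q - E) + (t + 1) * ℓ → t < 0 → -q ≤ t →
      (t = h - 1 - q ∨ t = h - q) → ¬ (p : ℤ) ∣ t + q + 1 → ¬ p ∣ N.choose j := by
    intro j t hj hjt t0 t1 htt hpt
    rw [crit j hj]
    obtain ⟨d1, d2⟩ := aux_digits_eq q j (t + q) (t + 1 - h + q) ((h * q ^ c + (t + 1) * G) - 1)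
      (by rw [hform j t hjt]; ring) (by omega) (by omega) (by omega) (by omega)
    refine ⟨by omega, ?_⟩
    rw [← Int.natCast_dvd_natCast, Nat.cast_add, d1]; exact_mod_cast hpt
  have p2 := hp.two_le
  have hp1 : ∀ n : ℕ, p ∣ n → ¬ p ∣ n + 1 := by
    intro n h1 h2
    exact hp.one_lt.ne' (Nat.dvd_one.mp ((Nat.dvd_add_right h1).mp h2))
  have hp2 : ¬ p ∣ h → p = 2 ∧ h % 2 = 1 := by
    intro hn
    rcases hp.dvd_mul.mp hph with h' | h'
    · have : p = 2 := (Nat.prime_dvd_prime_iff_eq hp Nat.prime_two).mp h'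
      subst this
      exact ⟨rfl, by omega⟩
    · exact absurd h' hn
  have hpm : ¬ p ∣ h → p ∣ h - 1 ∧ p ∣ h + 1 := by
    intro hn
    obtain ⟨h2, h3⟩ := hp2 hn
    subst h2
    omega
  have hpm' : p ∣ h → ¬ p ∣ h - 1 := by
    intro hd hc
    have := hp1 _ hc
    rw [show h - 1 + 1 = h by omega] at this
    exact this hd
  have h2q1 : 2 * h ≠ q + 1 := by
    intro hc
    rw [hc] at hph
    exact hp1 q hpq hph
  have close : ∀ (t : ℤ) (j₀ : ℕ), ℓ ∣ r * (ℓ - (q - 1)) + j₀ → (j₀ : ℤ) = q - 1 - h * (q - E) + (t + 1) * ℓ →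
      ¬ p ∣ N.choose j₀ → (∀ t' : ℤ, - (h : ℤ) ≤ t' → t' ≤ q - 1 - h →
        ((t' = h - 2 ∧ ¬ p ∣ h - 1) ∨ (t' = h - 1 ∧ ¬ p ∣ h) ∨ (t' = h - 1 - q ∧ ¬ p ∣ h) ∨
          (t' = h - q ∧ ¬ p ∣ h + 1)) → t' = t) → False := by
    intro t j₀ hd hj hn hu
    refine aux_single p N ℓ _ a ha hsum j₀ hd hn ?_
    intro j h1 h2 h3
    obtain ⟨t', ht', b1, b2, hh⟩ := huniq j h1 h2 h3
    have := hu t' b1 b2 hh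
    subst this
    have : (j : ℤ) = j₀ := by rw [ht', hj]
    exact_mod_cast this
  rcases lt_trichotomy (2 * h) q with hlt | heq | hgt
  · by_cases hd : p ∣ h
    · have hpl := Nat.le_of_dvd (by omega) hd
      obtain ⟨j₀, hj₀, hjd, hjt⟩ := hex (h - 2) (Or.inl ⟨by omega, by omega⟩)
      refine close _ j₀ hjd hjt (hnvP j₀ _ hj₀ hjt (by omega) (by omega) (Or.inl rfl) ?_) ?_
      · rw [show (h : ℤ) - 2 + 1 = ((h - 1 : ℕ) : ℤ) by omega, Int.natCast_dvd_natCast]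
        exact hpm' hd
      · intro t' b1 b2 hh
        rcases hh with hh | hh | hh | hh
        · exact hh.1
        · exact absurd hd hh.2
        · exact absurd hd hh.2
        · omega
    · obtain ⟨j₀, hj₀, hjd, hjt⟩ := hex (h - 1) (Or.inl ⟨by omega, by omega⟩)
      refine close _ j₀ hjd hjt (hnvP j₀ _ hj₀ hjt (by omega) (by omega) (Or.inr rfl) ?_) ?_
      · rw [show (h : ℤ) - 1 + 1 = (h : ℤ) by omega, Int.natCast_dvd_natCast]
        exact hd
      · intro t' b1 b2 hh
        rcases hh with hh | hh | hh | hh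
        · exact absurd (hpm hd).1 hh.2
        · exact hh.1
        · omega
        · exact absurd (hpm hd).2 hh.2
  · have h2 : p = 2 := by
      have : 2 ∣ p ^ m := by rw [← hq, ← heq]; exact dvd_mul_right 2 h
      exact ((Nat.prime_dvd_prime_iff_eq Nat.prime_two hp).mp (Nat.prime_two.dvd_of_dvd_pow this)).symm
    subst h2
    have hm2 : 2 ≤ m := by
      by_contra hc
      have : m = 1 := by omega
      subst this; omega
    have hd : 2 ∣ h := by
      have : 2 * 2 ∣ 2 * h := by
        rw [heq, hq]; exact pow_dvd_pow 2 hm2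
      omega
    obtain ⟨j₀, hj₀, hjd, hjt⟩ := hex (h - 2) (Or.inl ⟨by omega, by omega⟩)
    obtain ⟨j₁, hj₁, hjd₁, hjt₁⟩ := hex (-h) (Or.inr ⟨rfl, by omega⟩)
    have hdiff : j₀ = j₁ + (q - 2) * ℓ := by
      have hqh : (q : ℤ) = 2 * h := by omega
      zify [show 2 ≤ q by omega]
      rw [hjt, hjt₁, hqh]; ring
    obtain ⟨l0, l1, hpow⟩ := aux_double N ℓ _ a hsum j₀ j₁
      (by
        have : 0 < (q - 2) * ℓ := Nat.mul_pos (by omega) (by omega)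
        omega)
      hjd (hnvP j₀ _ hj₀ hjt (by omega) (by omega) (Or.inl rfl) (by push_cast; omega))
      hjd₁ (hnvN j₁ _ hj₁ hjt₁ (by omega) (by omega) (Or.inr (by omega)) (by push_cast; omega))
      (by
        intro j h1 h2 h3
        obtain ⟨t', ht', b1, b2, hh⟩ := huniq j h1 h2 h3
        have : t' = h - 2 ∨ t' = -h := by omega
        rcases this with rfl | rfl
        · left
          have : (j : ℤ) = j₀ := by rw [ht', hjt]
          exact_mod_cast this
        · right
          have : (j : ℤ) = j₁ := by rw [ht', hjt₁]
          exact_mod_cast this)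
    apply hA
    rw [CharTwo.neg_eq]
    have e1 : N - j₁ = (N - j₀) + ℓ * (q - 2) := by rw [mul_comm ℓ]; omega
    rw [e1, pow_add, pow_mul] at hpow
    have e2 : (a ^ ℓ) ^ (q - 2) = 1 := by
      have := pow_ne_zero (N - j₀) ha
      exact mul_left_cancel₀ this (by rw [mul_one]; exact hpow.symm)
    have e3 : (a ^ ℓ) ^ (q - 1) = 1 := by
      rw [← pow_mul, mul_comm, hℓ, ← hF]
      exact FiniteField.pow_card_sub_one_eq_one a ha
    rw [show q - 1 = (q - 2) + 1 by omega, pow_succ, e2, one_mul] at e3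
    exact e3
  · by_cases hd : p ∣ h
    · obtain ⟨j₀, hj₀, hjd, hjt⟩ := hex (h - q) (Or.inl ⟨by omega, by omega⟩)
      refine close _ j₀ hjd hjt (hnvN j₀ _ hj₀ hjt (by omega) (by omega) (Or.inr rfl) ?_) ?_
      · rw [show (h : ℤ) - q + q + 1 = ((h + 1 : ℕ) : ℤ) by push_cast; ring, Int.natCast_dvd_natCast]
        exact hp1 h hd
      · intro t' b1 b2 hh
        rcases hh with hh | hh | hh | hh
        · omega
        · exact absurd hd hh.2
        · exact absurd hd hh.2
        · exact hh.1
    · obtain ⟨j₀, hj₀, hjd, hjt⟩ := hex (h - 1 - q) (Or.inl ⟨by omega, by omega⟩)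
      refine close _ j₀ hjd hjt (hnvN j₀ _ hj₀ hjt (by omega) (by omega) (Or.inl rfl) ?_) ?_
      · rw [show (h : ℤ) - 1 - q + q + 1 = (h : ℤ) by ring, Int.natCast_dvd_natCast]
        exact hd
      · intro t' b1 b2 hh
        rcases hh with hh | hh | hh | hh
        · exact absurd (hpm hd).1 hh.2
        · omega
        · exact hh.1
        · exact absurd (hpm hd).2 hh.2

/-- For `q ≥ 3`, `e ≥ 3`, and `(-a)^ℓ ≠ 1`, if the least nonnegative residue of `r`
modulo `ℓ = q^{e-1} + ⋯ + q + 1` equals `h(ℓ - q^{e-1} - 1) + 1` for some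
`1 ≤ h ≤ q - 1`, then `f(x) = x^r (x^{q-1} + a)` does not permute `F_{q^e}`. -/
theorem stmt_15 (p m q e : ℕ) (hp : p.Prime) (hm : 0 < m) (hq : q = p ^ m)
    (hq3 : 3 ≤ q) (he : 3 ≤ e)
    {F : Type*} [Field F] [Fintype F] (hF : Fintype.card F = q ^ e)
    (a : F) (ha : a ≠ 0) (r : ℕ) (hr : 1 ≤ r)
    (ℓ : ℕ) (hℓ : ℓ = ∑ i ∈ Finset.range e, q ^ i)
    (hA : (-a) ^ ℓ ≠ 1)
    (h : ℕ) (hh1 : 1 ≤ h) (hh2 : h ≤ q - 1)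
    (hres : ((r % ℓ : ℕ) : ℤ) = h * ((ℓ : ℤ) - (q : ℤ) ^ (e - 1) - 1) + 1) :
    ¬ Function.Bijective (fun x : F => x ^ r * (x ^ (q - 1) + a)) := by
  intro hb
  have := Fact.mk hp
  have hchar : CharP F p := by
    rw [hq, ← pow_mul] at hF
    exact charP_of_card_eq_prime_pow hF
  obtain ⟨c, rfl⟩ := Nat.exists_eq_add_of_le' he
  have hℓ' : (q - 1) * ℓ = q ^ (c + 3) - 1 := by
    rw [hℓ, Nat.geomSum_eq (show 2 ≤ q by omega)]
    exact Nat.mul_div_cancel' (by simpa using Nat.sub_dvd_pow_sub_pow q 1 (c + 3))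
  have hℓG : ℓ = 1 + q + q ^ 2 * ∑ i ∈ Finset.range (c + 1), q ^ i := by
    rw [hℓ, Finset.sum_range_succ', Finset.sum_range_succ', Finset.mul_sum]
    simp only [zero_add, pow_one, pow_zero]
    rw [Finset.sum_congr rfl (fun i _ => show q ^ (i + 1 + 1) = q ^ 2 * q ^ i by ring)]
    ring
  have hres' : ∃ w : ℤ, (r : ℤ) = 1 - h * (q ^ (c + 3 - 1) + 1) + w * ℓ := by
    have hmod : ((r % ℓ : ℕ) : ℤ) + ℓ * ((r / ℓ : ℕ) : ℤ) = r := by exact_mod_cast Nat.mod_add_div r ℓ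
    exact ⟨((r / ℓ : ℕ) : ℤ) + h, by linear_combination hres - hmod⟩
  exact aux_case2 p m q (c + 3) c hp hm hq hq3 rfl hF a ha r hr ℓ _ hℓG hℓ' hA h hh1 hh2 hres' hb
    (aux_case1 p m q (c + 3) c hp hm hq hq3 rfl hF a ha r hr ℓ _ hℓG hℓ' h hh1 hh2 hres' hb)
end

section
/- Let q be a prime power, e ∈ {2, 3, 4}, a ∈ F_{q^e} nonzero, r ≥ 1, f(x) = x^r(x^{q−1} + a), and ℓ = q^{e−1} + ⋯ + q + 1. Then f permutes F_{q^e} if and only if (−a)^ℓ ≠ 1, gcd(r, q−1) = 1, and the least nonnegative residue of r modulo ℓ lies in {1, ℓ − q}. -/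
theorem lucas_pow_aux {p : ℕ} [Fact p.Prime] (v : ℕ) : ∀ n k : ℕ,
    n.choose k ≡ (n % p ^ v).choose (k % p ^ v) * (n / p ^ v).choose (k / p ^ v) [MOD p] := by
  induction v with
  | zero => intro n k; simp [Nat.mod_one]; rfl
  | succ v ih =>
    intro n k
    have h1 := Choose.choose_modEq_choose_mod_mul_choose_div_nat (p := p) (n := n) (k := k)
    have h2 := ih (n / p) (k / p)
    have h3 := Choose.choose_modEq_choose_mod_mul_choose_div_nat (p := p)
      (n := n % p ^ (v+1)) (k := k % p ^ (v+1))
    have e1 : ∀ n, n % p ^ (v+1) % p = n % p := fun n =>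
      Nat.mod_mod_of_dvd _ (dvd_pow_self p (Nat.succ_ne_zero v))
    have e2 : ∀ n, n % p ^ (v+1) / p = n / p % p ^ v := fun n => by
      rw [pow_succ', Nat.mod_mul_right_div_self]
    have e3 : ∀ n, n / p / p ^ v = n / p ^ (v+1) := fun n => by
      rw [Nat.div_div_eq_div_mul, pow_succ']
    rw [e1, e1, e2, e2] at h3
    rw [e3, e3] at h2
    calc _ ≡ _ [MOD p] := h1
      _ ≡ _ [MOD p] := h2.mul_left _
      _ = _ := (mul_assoc _ _ _).symm
      _ ≡ _ [MOD p] := (h3.symm).mul_right _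

theorem lucas_F {F : Type*} [Field F] {p : ℕ} [Fact p.Prime] [CharP F p] (v n k : ℕ) :
    (n.choose k : F) = ((n % p ^ v).choose (k % p ^ v) : F) * ((n / p ^ v).choose (k / p ^ v) : F) := by
  rw [← Nat.cast_mul]
  exact CharP.natCast_eq_natCast' F p (lucas_pow_aux v n k)

/-- `C(R-u, i) = (-1)^i C(i+u-1, u-1)` in characteristic p. -/
theorem choose_neg {F : Type*} [Field F] {p : ℕ} [Fact p.Prime] [CharP F p] (M : ℕ) :
    ∀ u i : ℕ, i + u + 1 ≤ p ^ M →
      ((p ^ M - (u + 1)).choose i : F) = (-1) ^ i * ((i + u).choose u : F) := by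
  intro u
  induction u with
  | zero =>
    intro i
    induction i with
    | zero => intro _; simp
    | succ i ih =>
      intro h
      have h1 := ih (by omega)
      have h2 : (p ^ M).choose (i+1) = (p ^ M - 1).choose i + (p ^ M - 1).choose (i+1) := by
        rw [← Nat.choose_succ_succ, Nat.succ_eq_add_one, Nat.sub_add_cancel (by omega)]
      have h3 : (((p ^ M).choose (i+1) : ℕ) : F) = 0 := by
        rw [CharP.cast_eq_zero_iff F p]
        exact Nat.Prime.dvd_choose_pow Fact.out (by omega) (by omega)
      rw [h2] at h3
      push_cast at h3
      simp at h1 ⊢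
      rw [h1] at h3
      rw [pow_succ]
      linear_combination h3
  | succ u ihu =>
    intro i
    induction i with
    | zero => intro _; simp
    | succ i ih =>
      intro h
      have h1 := ih (by omega)
      have h2 := ihu (i+1) (by omega)
      have h3 : (p ^ M - (u+1)).choose (i+1) =
          (p ^ M - (u+1+1)).choose i + (p ^ M - (u+1+1)).choose (i+1) := by
        rw [← Nat.choose_succ_succ]; congr 1; omega
      have h4 : (i+1+(u+1)).choose (u+1) = (i+1+u).choose u + (i+(u+1)).choose (u+1) := by
        rw [show i+1+(u+1) = (i+1+u)+1 by ring, Nat.choose_succ_succ]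
        rw [show i+1+u = i+(u+1) by ring]
      rw [h3] at h2
      rw [h4]
      push_cast at h2 ⊢
      rw [h1] at h2
      rw [pow_succ] at h2 ⊢
      linear_combination h2

/-- Power sums. -/
theorem sum_pow_F {F : Type*} [Field F] [Fintype F] (n : ℕ) (hn : 0 < n) :
    ∑ x : F, x ^ n = if Fintype.card F - 1 ∣ n then -1 else 0 := by
  classical
  rw [← FiniteField.sum_pow_units F n]
  let φ : Fˣ ↪ F := ⟨fun x ↦ x, Units.val_injective⟩
  have h : Finset.univ.map φ = Finset.univ \ {0} := by
    ext x
    simpa only [Finset.mem_map, Finset.mem_univ, Function.Embedding.coeFn_mk, true_and,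
      Finset.mem_sdiff, Finset.mem_singleton, φ] using! isUnit_iff_ne_zero
  calc ∑ x : F, x ^ n = ∑ x ∈ Finset.univ \ {(0 : F)}, x ^ n := by
        rw [← Finset.sum_sdiff ({0} : Finset F).subset_univ, Finset.sum_singleton,
          zero_pow hn.ne', add_zero]
    _ = ∑ x : Fˣ, (x ^ n : F) := by simp [φ, ← h]

theorem hermite {F : Type*} [Field F] [Fintype F] (q e ℓ r : ℕ) (hq : 2 ≤ q)
    (hF : Fintype.card F = q ^ e) (hℓ : (q - 1) * ℓ = q ^ e - 1) (a : F) (hr : 1 ≤ r)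
    (hf : Function.Bijective (fun x : F => x ^ r * (x ^ (q - 1) + a))) (t : ℕ) (ht : 0 < t)
    (htl : t < ℓ) :
    ∑ i ∈ Finset.range ((q-1)*t+1), (if ℓ ∣ r * t + i then
      (((q-1)*t).choose i : F) * a ^ ((q-1)*t - i) else 0) = 0 := by
  have h1 : ∑ x : F, (x ^ r * (x ^ (q - 1) + a)) ^ ((q-1)*t) = 0 := by
    have := Equiv.sum_comp (Equiv.ofBijective _ hf) (fun x : F => x ^ ((q-1)*t))
    simp only [Equiv.ofBijective_apply] at this
    rw [this]
    apply FiniteField.sum_pow_lt_card_sub_one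
    rw [hF, ← hℓ]
    exact Nat.mul_lt_mul_of_pos_left htl (by omega)
  have h2 : ∀ x : F, (x ^ r * (x ^ (q - 1) + a)) ^ ((q-1)*t) =
      ∑ i ∈ Finset.range ((q-1)*t+1), (((q-1)*t).choose i : F) * a ^ ((q-1)*t - i) *
        x ^ ((q-1)*(r*t+i)) := by
    intro x
    rw [mul_pow, add_pow, Finset.mul_sum]
    refine Finset.sum_congr rfl fun i _ => ?_
    rw [mul_add, pow_add, ← pow_mul, ← pow_mul]
    rw [show r * ((q-1)*t) = (q-1)*(r*t) by ring]
    ring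
  simp_rw [h2] at h1
  rw [Finset.sum_comm] at h1
  simp_rw [← Finset.mul_sum] at h1
  apply neg_eq_zero.1
  refine Eq.trans ?_ h1
  rw [← Finset.sum_neg_distrib]
  refine Finset.sum_congr rfl fun i _ => ?_
  have hpos : 0 < (q-1)*(r*t+i) := by
    apply Nat.mul_pos (by omega)
    have := Nat.mul_pos hr ht
    omega
  rw [sum_pow_F _ hpos, hF, ← hℓ]
  simp only [Nat.mul_dvd_mul_iff_left (show 0 < q - 1 by omega)]
  split_ifs <;> simp

section core
variable {F : Type*} [Field F] {p : ℕ} [Fact p.Prime] [CharP F p]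

theorem coef_eq (M v k i0 : ℕ) (h : i0 + v + 1 ≤ p ^ M) :
    (((p ^ M - 1) * (v + 1)).choose (p ^ M * k + i0) : F) =
      (v.choose k : F) * ((-1) ^ i0 * ((i0 + v).choose v : F)) := by
  rw [lucas_F (p := p) M]
  have e : (p ^ M - 1) * (v + 1) = p ^ M * v + (p ^ M - (v + 1)) := by
    zify [show 1 ≤ p ^ M by omega, show v + 1 ≤ p ^ M by omega]; ring
  have hpos : 0 < p ^ M := by omega
  rw [e, Nat.mul_add_mod, Nat.mul_add_mod, Nat.mul_add_div hpos, Nat.mul_add_div hpos,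
    Nat.mod_eq_of_lt (show p ^ M - (v+1) < p ^ M by omega), Nat.mod_eq_of_lt (show i0 < p ^ M by omega),
    Nat.div_eq_of_lt (show p ^ M - (v+1) < p ^ M by omega), Nat.div_eq_of_lt (show i0 < p ^ M by omega),
    choose_neg M v i0 h]
  simp
  ring

theorem split_eq (M v q L J ℓ i : ℕ) (hℓ : ℓ = p ^ M + L) (hqL : ℓ = q * L + 1)
    (hv : v + 1 ≤ q) (hq : q ≤ p ^ M) (hJ : J + 2 ≤ L)
    (hd : ℓ ∣ (J + 1) * (v + 1) + i) 
    (hC : (((p ^ M - 1) * (v + 1)).choose i : F) ≠ 0) :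
    ∃ k i0, i = p ^ M * k + i0 ∧ i0 + v + 1 ≤ p ^ M ∧ k ≤ v ∧ (v.choose k : F) ≠ 0 ∧
      ((i0 + v).choose v : F) ≠ 0 ∧
      (L * k = (J + 1) * (v + 1) + i0 ∨ L * (k + 1) + p ^ M = (J + 1) * (v + 1) + i0) := by
  have hpos : 0 < p ^ M := by omega
  obtain ⟨k, i0, hi, hi0⟩ : ∃ k i0, i = p ^ M * k + i0 ∧ i0 < p ^ M :=
    ⟨i / p ^ M, i % p ^ M, (Nat.div_add_mod _ _).symm, Nat.mod_lt _ hpos⟩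
  have e : (p ^ M - 1) * (v + 1) = p ^ M * v + (p ^ M - (v + 1)) := by
    zify [show 1 ≤ p ^ M by omega, show v + 1 ≤ p ^ M by omega]; ring
  have hle : i0 + v + 1 ≤ p ^ M := by
    by_contra hcon
    apply hC
    rw [lucas_F (p := p) M, hi, e, Nat.mul_add_mod, Nat.mul_add_mod,
      Nat.mod_eq_of_lt (show p ^ M - (v+1) < p ^ M by omega), Nat.mod_eq_of_lt hi0,
      Nat.choose_eq_zero_of_lt (by omega)]
    simp
  subst hi
  rw [coef_eq M v k i0 hle] at hC
  have h1 : (v.choose k : F) ≠ 0 := fun h => hC (by rw [h]; simp)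
  have h2 : ((i0 + v).choose v : F) ≠ 0 := fun h => hC (by rw [h]; simp)
  have hk : k ≤ v := by
    by_contra hcon
    exact h1 (by rw [Nat.choose_eq_zero_of_lt (by omega)]; simp)
  refine ⟨k, i0, rfl, hle, hk, h1, h2, ?_⟩
  have hd' : (ℓ : ℤ) ∣ (J + 1) * (v + 1) + i0 - L * k := by
    have : (ℓ : ℤ) ∣ (J + 1) * (v + 1) + (p ^ M * k + i0) := by exact_mod_cast hd
    have h3 : ((J + 1) * (v + 1) + i0 - L * k : ℤ) =
      (J + 1) * (v + 1) + (p ^ M * k + i0) - ℓ * k := by rw [hℓ]; push_cast; ring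
    rw [h3]; exact dvd_sub this (dvd_mul_right _ _)
  obtain ⟨z, hz⟩ := hd'
  have hqL' : (ℓ : ℤ) = q * L + 1 := by exact_mod_cast hqL
  have hℓ' : (ℓ : ℤ) = p ^ M + L := by exact_mod_cast hℓ
  have b1 : (L * k : ℤ) < q * L := by
    have : k < q := by omega
    have hL : 0 < L := by omega
    have := Nat.mul_lt_mul_of_pos_right this hL
    push_cast [mul_comm] at *
    exact_mod_cast (by linarith)
  have b2 : ((J + 1) * (v + 1) + i0 : ℤ) < p ^ M + q * L := by
    have h4 : (J : ℤ) * (v + 1) ≤ L * q := by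
      have := Nat.mul_le_mul (show J ≤ L by omega) hv
      exact_mod_cast this
    have h5 : (i0 + v + 1 : ℤ) ≤ p ^ M := by exact_mod_cast hle
    have h6 : (J + 1) * (v + 1) + i0 < p ^ M + q * L := by
      have h4' : J * (v + 1) < L * q := by
        calc J * (v+1) ≤ J * q := Nat.mul_le_mul_left _ hv
          _ < L * q := Nat.mul_lt_mul_of_pos_right (by omega) (by omega)
      nlinarith
    exact_mod_cast h6
  have hz0 : -1 < z := by
    by_contra hcon
    have : (ℓ : ℤ) * z ≤ ℓ * (-1) := mul_le_mul_of_nonneg_left (by omega) (by positivity)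
    have h0 : (0 : ℤ) ≤ (J + 1) * (v + 1) + i0 := by positivity
    linarith
  have hz2 : z < 2 := by
    by_contra hcon
    have : (ℓ : ℤ) * 2 ≤ ℓ * z := mul_le_mul_of_nonneg_left (by omega) (by positivity)
    have h0 : (0 : ℤ) ≤ L * k := by positivity
    have h0' : (0 : ℤ) ≤ L := by positivity
    linarith
  have : z = 0 ∨ z = 1 := by omega
  rcases this with rfl | rfl
  · left
    zify; linarith
  · right
    zify; rw [hℓ'] at hz; linarith

theorem dvd_one (R v L J ℓ k i0 : ℕ) (hℓ : ℓ = R + L)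
    (h : L * k = (J + 1) * (v + 1) + i0) : ℓ ∣ (J + 1) * (v + 1) + (R * k + i0) :=
  ⟨k, by rw [hℓ]; linarith⟩

theorem dvd_two (R v L J ℓ k i0 : ℕ) (hℓ : ℓ = R + L)
    (h : L * (k + 1) + R = (J + 1) * (v + 1) + i0) : ℓ ∣ (J + 1) * (v + 1) + (R * k + i0) :=
  ⟨k + 1, by rw [hℓ]; linarith⟩

end core

section cases
variable {F : Type*} [Field F] {p : ℕ} [Fact p.Prime] [CharP F p]

theorem single_contra (a : F) (ha : a ≠ 0) (ℓ b s : ℕ)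
    (H : ∑ i ∈ Finset.range (s + 1), (if ℓ ∣ b + i then (s.choose i : F) * a ^ (s - i) else 0) = 0)
    (i : ℕ) (hd : ℓ ∣ b + i) (hC : (s.choose i : F) ≠ 0)
    (hu : ∀ i', ℓ ∣ b + i' → (s.choose i' : F) ≠ 0 → i' = i) : False := by
  rw [Finset.sum_eq_single i, if_pos hd] at H
  · exact mul_ne_zero hC (pow_ne_zero _ ha) H
  · intro b' _ hb'
    split_ifs with h
    · by_contra hne
      exact hb' (hu b' h (left_ne_zero_of_mul hne))
    · rfl
  · intro hi
    exfalso
    apply hC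
    rw [Nat.choose_eq_zero_of_lt (by simpa using hi)]
    simp

theorem case_odd (a : F) (ha : a ≠ 0) (M q L J ℓ : ℕ) (hℓ : ℓ = p ^ M + L) (hqL : ℓ = q * L + 1)
    (hpq : p ∣ q) (hq2 : 2 ≤ q) (hpL : q ∣ L - 1) (hqR : q ∣ p ^ M)
    (hJ : J + 2 ≤ L) (hp2 : p ≠ 2) (hJp : ¬ p ∣ J)
    (H : ∑ i ∈ Finset.range ((p ^ M - 1) * (1 + 1) + 1), (if ℓ ∣ (J + 1) * (1 + 1) + i then
      (((p ^ M - 1) * (1 + 1)).choose i : F) * a ^ ((p ^ M - 1) * (1 + 1) - i) else 0) = 0) :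
    False := by
  have hpp : p.Prime := Fact.out
  have hRpos : 0 < p ^ M := pow_pos hpp.pos _
  have hqle : q ≤ p ^ M := Nat.le_of_dvd hRpos hqR
  have h2J : ¬ p ∣ 2 * J := by
    intro h
    rcases hpp.dvd_mul.1 h with h | h
    · exact hp2 ((Nat.prime_dvd_prime_iff_eq hpp Nat.prime_two).1 h)
    · exact hJp h
  have hLF : (L : F) = 1 := by
    obtain ⟨c, hc⟩ := hpq.trans hpL
    have : L = p * c + 1 := by omega
    rw [this]; simp
  have hRF : ((p ^ M : ℕ) : F) = 0 := (CharP.cast_eq_zero_iff F p _).2 (hpq.trans hqR)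
  have h2JF : ((2 * J : ℕ) : F) ≠ 0 := fun h => h2J ((CharP.cast_eq_zero_iff F p _).1 h)
  have hne : L ≠ 2 * J + 1 := by
    intro h
    apply h2J
    have := hpq.trans hpL
    rwa [h] at this
  have key : ∀ i0 : ℕ, (L = 2 * J + 2 + i0 ∨ L + p ^ M = 2 * J + 2 + i0) →
      ((i0 + 1).choose 1 : F) ≠ 0 := by
    intro i0 h
    rw [Nat.choose_one_right]
    intro h0
    apply h2JF
    rcases h with h | h
    · have := congrArg (Nat.cast : ℕ → F) h
      push_cast at this h0 ⊢
      rw [hLF] at this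
      linear_combination -h0 - this
    · have := congrArg (Nat.cast : ℕ → F) h
      push_cast at this h0 hRF ⊢
      rw [hLF, hRF] at this
      linear_combination -h0 - this
  have hqL2 : L ≤ p ^ M := by
    have h1 : ℓ = q * L + 1 := hqL
    have : 2 * L ≤ q * L := Nat.mul_le_mul_right _ hq2
    omega
  by_cases hc : 2 * J + 2 ≤ L
  · obtain ⟨i0, hi0⟩ := Nat.exists_eq_add_of_le hc
    refine single_contra a ha ℓ _ _ H (p ^ M * 1 + i0) (dvd_one _ 1 L J ℓ 1 i0 hℓ (by omega)) ?_ ?_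
    · rw [coef_eq M 1 1 i0 (by omega)]
      refine mul_ne_zero (by simp) (mul_ne_zero (by simp) (key i0 (Or.inl hi0)))
    · intro i' hd hC
      obtain ⟨k, i1, rfl, h1, h2, h3, h4, h5⟩ := split_eq M 1 q L J ℓ i' hℓ hqL (by omega) hqle hJ hd hC
      have : k = 0 ∨ k = 1 := by omega
      rcases this with rfl | rfl
      · omega
      · omega
  · obtain ⟨i0, hi0⟩ := Nat.exists_eq_add_of_le (show 2 * J + 2 ≤ L + p ^ M by omega)
    refine single_contra a ha ℓ _ _ H (p ^ M * 0 + i0) (dvd_two _ 1 L J ℓ 0 i0 hℓ (by omega)) ?_ ?_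
    · rw [coef_eq M 1 0 i0 (by omega)]
      refine mul_ne_zero (by simp) (mul_ne_zero (by simp) (key i0 (Or.inr hi0)))
    · intro i' hd hC
      obtain ⟨k, i1, rfl, h1, h2, h3, h4, h5⟩ := split_eq M 1 q L J ℓ i' hℓ hqL (by omega) hqle hJ hd hC
      have : k = 0 ∨ k = 1 := by omega
      rcases this with rfl | rfl
      · omega
      · omega

end cases

set_option maxHeartbeats 1000000 in
theorem case_big {F : Type*} [Field F] {p : ℕ} [Fact p.Prime] [CharP F p] (a : F) (ha : a ≠ 0)
    (κ M d v q Q L J J0 ℓ T g ρ : ℕ)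
    (hQ : Q = p ^ κ) (hκ : κ ≠ 0) (hQd : Q = d + 2) (hv : v = Q + d) (hq : q = p * Q * g)
    (hg : 0 < g)
    (hℓ : ℓ = p ^ M + L) (hqL : ℓ = q * L + 1)
    (hL : L = T * q + 1) (hT : 1 ≤ T) (hR : p ^ M = q * ρ)
    (hJ : J + 2 ≤ L) (hJ0 : J = Q * J0) (hJp : ¬ p ∣ J0)
    (H : ∑ i ∈ Finset.range ((p ^ M - 1) * (v + 1) + 1), (if ℓ ∣ (J + 1) * (v + 1) + i then
      (((p ^ M - 1) * (v + 1)).choose i : F) * a ^ ((p ^ M - 1) * (v + 1) - i) else 0) = 0) :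
    (-a) ^ ℓ = 1 := by
  have hpp : p.Prime := Fact.out
  have hRpos : 0 < p ^ M := pow_pos hpp.pos _
  have hqle : q ≤ p ^ M := Nat.le_of_dvd hRpos ⟨ρ, hR⟩
  have hp2 := hpp.two_le
  have h2Q : 2 * Q ≤ q := by
    rw [hq]
    calc 2 * Q ≤ p * Q := Nat.mul_le_mul_right _ hp2
      _ ≤ p * Q * g := Nat.le_mul_of_pos_right _ hg
  have hvq : v + 1 ≤ q := by omega
  have hpF : (p : F) = 0 := CharP.cast_eq_zero F p
  have hQF : (Q : F) = 0 := by rw [hQ]; push_cast; rw [hpF, zero_pow hκ]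
  have hdF : (d : F) = -2 := by
    have := congrArg (Nat.cast : ℕ → F) hQd
    push_cast at this; rw [hQF] at this; linear_combination -this
  have hvF : (v : F) = -2 := by rw [hv]; push_cast; rw [hQF, hdF]; ring
  have hJ0F : (J0 : F) ≠ 0 := fun h => hJp ((CharP.cast_eq_zero_iff F p _).1 h)
  have hqF : (q : F) = 0 := by rw [hq]; push_cast; rw [hpF]; ring
  have hLF : (L : F) = 1 := by rw [hL]; push_cast; rw [hqF]; ring
  have hck : ∀ k, ((v.choose k : ℕ) : F) =
      ((d.choose (k % Q) : ℕ) : F) * ((Nat.choose 1 (k / Q) : ℕ) : F) := by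
    intro k
    rw [lucas_F (p := p) κ, ← hQ, hv, Nat.add_mod_left, Nat.mod_eq_of_lt (show d < Q by omega),
      Nat.add_div_left _ (by omega), Nat.div_eq_of_lt (show d < Q by omega)]
  have hN : ∀ N, ((N.choose v : ℕ) : F) =
      (((N % Q).choose d : ℕ) : F) * ((N / Q : ℕ) : F) := by
    intro N
    rw [lucas_F (p := p) κ, ← hQ, hv, Nat.add_mod_left, Nat.mod_eq_of_lt (show d < Q by omega),
      Nat.add_div_left _ (by omega), Nat.div_eq_of_lt (show d < Q by omega), Nat.choose_one_right]
  have hQZ : (Q : ℤ) = d + 2 := by exact_mod_cast hQd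
  have hqZ : (q : ℤ) = p * Q * g := by exact_mod_cast hq
  have hLZ : (L : ℤ) = T * q + 1 := by exact_mod_cast hL
  have hJZ : (J : ℤ) = Q * J0 := by exact_mod_cast hJ0
  have hRZ : (p : ℤ) ^ M = q * ρ := by exact_mod_cast hR
  have cong1 : ∀ k i0 : ℕ, L * k = (J + 1) * (v + 1) + i0 →
      ((i0 + v : ℕ) : ℤ) + 1 = k + Q * (T * p * g * k - J0 * (v + 1)) := by
    intro k i0 h
    have hz : (L : ℤ) * k = (J + 1) * (v + 1) + i0 := by exact_mod_cast h
    push_cast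
    rw [hLZ, hJZ, hqZ] at hz
    linear_combination -hz
  have cong2 : ∀ k i0 : ℕ, L * (k + 1) + p ^ M = (J + 1) * (v + 1) + i0 →
      ((i0 + v : ℕ) : ℤ) = k + Q * (T * p * g * (k + 1) - J0 * (v + 1) + p * g * ρ) := by
    intro k i0 h
    have hz : (L : ℤ) * (k + 1) + p ^ M = (J + 1) * (v + 1) + i0 := by exact_mod_cast h
    push_cast
    rw [hLZ, hJZ, hRZ, hqZ] at hz
    linear_combination -hz
  have small : ∀ (x z : ℤ), x = Q * z → -Q < x → x < Q → x = 0 := by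
    intro x z h h1 h2
    exact Int.eq_zero_of_abs_lt_dvd (m := (Q : ℤ)) (x := x) ⟨z, h⟩ (abs_lt.2 ⟨h1, h2⟩)
  have uniq : ∀ k i0 : ℕ, i0 + v + 1 ≤ p ^ M → k ≤ v → ((v.choose k : ℕ) : F) ≠ 0 →
      (((i0 + v).choose v : ℕ) : F) ≠ 0 →
      (L * k = (J + 1) * (v + 1) + i0 ∨ L * (k + 1) + p ^ M = (J + 1) * (v + 1) + i0) →
      (k = Q ∧ L * Q = (J + 1) * (v + 1) + i0) ∨
      (k = d ∧ L * (d + 1) + p ^ M = (J + 1) * (v + 1) + i0) := by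
    intro k i0 hle hk h3 h4 h5
    rw [hck] at h3
    rw [hN] at h4
    have h3' : k % Q ≤ d := by
      by_contra hcon
      exact h3 (by rw [Nat.choose_eq_zero_of_lt (by omega)]; simp)
    have h4' : d ≤ (i0 + v) % Q := by
      by_contra hcon
      exact h4 (by rw [Nat.choose_eq_zero_of_lt (by omega)]; simp)
    have hlt : (i0 + v) % Q < Q := Nat.mod_lt _ (by omega)
    have hdm : (Q : ℤ) * ((i0 + v) / Q : ℕ) + ((i0 + v) % Q : ℕ) = ((i0 + v : ℕ) : ℤ) := by
      exact_mod_cast Nat.div_add_mod (i0 + v) Q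
    have hkm' := Nat.div_add_mod k Q
    have hkm : (Q : ℤ) * (k / Q : ℕ) + (k % Q : ℕ) = (k : ℤ) := by
      exact_mod_cast hkm'
    have hk1 : k / Q = 0 ∨ k / Q = 1 := by
      have : k / Q < 2 := by rw [Nat.div_lt_iff_lt_mul (by omega)]; omega
      exact Nat.le_one_iff_eq_zero_or_eq_one.1 (Nat.lt_succ_iff.1 this)
    generalize k / Q = k1 at *
    generalize k % Q = k2 at *
    generalize (i0 + v) % Q = N2 at *
    generalize (i0 + v) / Q = N1 at *
    rcases h5 with h5 | h5
    · left
      have hz := cong1 k i0 h5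
      have hk2 : k2 = 0 := by
        have hN2 : N2 = d ∨ N2 = d + 1 := by omega
        rcases hN2 with rfl | rfl
        · have := small ((k2 : ℤ) - N2 - 1) (N1 - k1 - (T * p * g * k - J0 * (v + 1)))
            (by rw [← hdm, ← hkm] at hz; rw [← hkm]; linear_combination -hz) (by omega) (by omega)
          omega
        · have := small (k2 : ℤ) (N1 + 1 - k1 - (T * p * g * k - J0 * (v + 1)))
            (by rw [← hdm, ← hkm] at hz; rw [← hkm]; push_cast at hz; linear_combination -hz - hQZ) (by omega) (by omega)
          omega
      rcases hk1 with rfl | rfl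
      · exfalso
        have : k = 0 := by omega
        subst this
        have : 0 < (J + 1) * (v + 1) := by positivity
        omega
      · have : k = Q := by omega
        subst this
        exact ⟨rfl, h5⟩
    · right
      have hz := cong2 k i0 h5
      have h0 := small ((k2 : ℤ) - N2) (N1 - k1 - (T * p * g * (k + 1) - J0 * (v + 1) + p * g * ρ))
            (by rw [← hdm, ← hkm] at hz; rw [← hkm]; linear_combination -hz) (by omega) (by omega)
      have hk2 : k2 = d := by omega
      rcases hk1 with rfl | rfl
      · have : k = d := by omega
        subst this
        exact ⟨rfl, h5⟩
      · exfalso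
        have : k = v := by omega
        subst this
        have h6 : J * (k + 1) < L * (k + 1) := Nat.mul_lt_mul_of_pos_right (by omega) (by omega)
        have h7 : (J + 1) * (k + 1) = J * (k + 1) + (k + 1) := by ring
        omega
  have divmod : ∀ (n c : ℕ) (z : ℤ), (n : ℤ) = c + Q * z → c < Q → n % Q = c ∧ ((n / Q : ℕ) : ℤ) = z := by
    intro n c z h hc
    have h1 : (n : ℤ) % Q = c := by
      rw [h, Int.add_mul_emod_self_left]
      exact Int.emod_eq_of_lt (by omega) (by omega)
    refine ⟨by exact_mod_cast h1, ?_⟩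
    push_cast
    rw [h, Int.add_mul_ediv_left _ _ (by omega), Int.ediv_eq_zero_of_lt (by omega) (by omega), zero_add]
  have hB : ∀ i0, L * Q = (J + 1) * (v + 1) + i0 → i0 + v + 1 ≤ p ^ M →
      (((p ^ M - 1) * (v + 1)).choose (p ^ M * Q + i0) : F) = (-1) ^ i0 * (- J0) := by
    intro i0 h hle
    obtain ⟨h1, h2⟩ := divmod (i0 + v) (d + 1) (L - 1 - J0 * (v + 1))
      (by have := cong1 Q i0 h; rw [hLZ, hqZ]; push_cast at this ⊢; linear_combination this + hQZ) (by omega)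
    have h3 := congrArg (Int.cast : ℤ → F) h2
    have hn := hN (i0 + v)
    rw [h1] at hn
    rw [Int.cast_natCast] at h3
    generalize (i0 + v) / Q = n at h3 hn
    push_cast at h3
    rw [hLF, hvF] at h3
    rw [coef_eq M v Q i0 hle, hck, hn, Nat.mod_self, Nat.div_self (by omega),
      Nat.choose_succ_self_right, h3]
    push_cast
    rw [hdF]; simp; ring
  have hA : ∀ i0, L * (d + 1) + p ^ M = (J + 1) * (v + 1) + i0 → i0 + v + 1 ≤ p ^ M →
      (((p ^ M - 1) * (v + 1)).choose (p ^ M * d + i0) : F) = (-1) ^ i0 * J0 := by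
    intro i0 h hle
    obtain ⟨h1, h2⟩ := divmod (i0 + v) d _ (cong2 d i0 h) (by omega)
    have h3 := congrArg (Int.cast : ℤ → F) h2
    have hn := hN (i0 + v)
    rw [h1] at hn
    rw [Int.cast_natCast] at h3
    generalize (i0 + v) / Q = n at h3 hn
    push_cast at h3
    rw [hpF, hvF] at h3
    rw [coef_eq M v d i0 hle, hck, hn, Nat.mod_eq_of_lt (show d < Q by omega),
      Nat.div_eq_of_lt (show d < Q by omega), h3]
    simp; ring
  have hRL : p ^ M + L = q * L + 1 := by omega
  have hsub : (J + 1) * (v + 1) = J * (v + 1) + (v + 1) := by ring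
  -- bounds
  have hLQ2 : L * Q + L ≤ q * L := by
    have : L * (Q + 1) ≤ L * q := Nat.mul_le_mul_left _ (by omega)
    linarith [mul_comm q L, mul_add L Q 1]
  have hjv : (J + 1) * (v + 1) + L ≤ q * L := by
    have h1 : (J + 1) * (v + 1) ≤ L * (v + 1) := Nat.mul_le_mul_right _ (by omega)
    have h2 : L * (v + 2) ≤ L * q := Nat.mul_le_mul_left _ (by omega)
    linarith [mul_comm q L, mul_add L (v+1) 1]
  have hLd : L * Q = L * (d + 1) + L := by rw [hQd]; ring
  have hqL' : q ≤ L := by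
    rw [hL]; have := Nat.mul_le_mul_right q hT; omega
  by_cases cA : L * (d + 1) ≤ J * (v + 1)
  · obtain ⟨iA, hiA⟩ := Nat.exists_eq_add_of_le (show (J + 1) * (v + 1) ≤ L * (d + 1) + p ^ M by omega)
    have hleA : iA + v + 1 ≤ p ^ M := by omega
    have hcA := hA iA hiA hleA
    have hneA : (((p ^ M - 1) * (v + 1)).choose (p ^ M * d + iA) : F) ≠ 0 := by
      rw [hcA]; exact mul_ne_zero (by simp) hJ0F
    have hdA := dvd_two _ v L J ℓ d iA hℓ hiA
    by_cases cB : (J + 1) * (v + 1) ≤ L * Q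
    · obtain ⟨iB, hiB⟩ := Nat.exists_eq_add_of_le cB
      have hleB : iB + v + 1 ≤ p ^ M := by omega
      have hcB := hB iB hiB hleB
      have hneB : (((p ^ M - 1) * (v + 1)).choose (p ^ M * Q + iB) : F) ≠ 0 := by
        rw [hcB]; exact mul_ne_zero (by simp) (neg_ne_zero.2 hJ0F)
      have hdB := dvd_one _ v L J ℓ Q iB hℓ hiB
      have hAB : p ^ M * Q + iB = p ^ M * d + iA + ℓ := by
        rw [hQd, hℓ]
        have : p ^ M * (d + 2) = p ^ M * d + 2 * p ^ M := by ring
        omega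
      have hBs : p ^ M * Q + iB ≤ (p ^ M - 1) * (v + 1) := by
        by_contra hcon
        exact hneB (by rw [Nat.choose_eq_zero_of_lt (by omega)]; simp)
      rw [Finset.sum_eq_add (p ^ M * d + iA) (p ^ M * Q + iB) (by omega), if_pos hdA, if_pos hdB,
        hcA, hcB] at H
      · have hs : (p ^ M - 1) * (v + 1) - (p ^ M * d + iA) =
            ((p ^ M - 1) * (v + 1) - (p ^ M * Q + iB)) + ℓ := by omega
        rw [hs, pow_add] at H
        have hane : a ^ ((p ^ M - 1) * (v + 1) - (p ^ M * Q + iB)) ≠ 0 := pow_ne_zero _ ha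
        have H2 : (-1 : F) ^ iA * a ^ ℓ = (-1) ^ iB := by
          apply mul_left_cancel₀ (mul_ne_zero hJ0F hane)
          linear_combination H
        have hpar : iA + L = iB + p ^ M := by omega
        have e1 : ((-1 : F) ^ iA) * (-1) ^ iA = 1 := by rw [← mul_pow]; simp
        rw [neg_pow, show a ^ ℓ = (-1 : F) ^ iA * (-1) ^ iB by
          rw [← H2]; linear_combination (-a ^ ℓ) * e1]
        rw [← pow_add, ← pow_add]
        apply Even.neg_one_pow
        exact ⟨iB + p ^ M, by omega⟩
      · intro c _ hcne
        split_ifs with h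
        · by_contra hne
          have hC := left_ne_zero_of_mul hne
          obtain ⟨k, i1, rfl, h1, h2, h3, h4, h5⟩ := split_eq M v q L J ℓ c hℓ hqL hvq hqle hJ h hC
          rcases uniq k i1 h1 h2 h3 h4 h5 with ⟨rfl, h6⟩ | ⟨rfl, h6⟩
          · omega
          · omega
        · rfl
      · intro h
        rw [Finset.mem_range] at h; omega
      · intro h
        rw [Finset.mem_range] at h; omega
    · exfalso
      refine single_contra a ha ℓ _ _ H _ hdA hneA ?_
      intro i' hd hC
      obtain ⟨k, i1, rfl, h1, h2, h3, h4, h5⟩ := split_eq M v q L J ℓ i' hℓ hqL hvq hqle hJ hd hC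
      rcases uniq k i1 h1 h2 h3 h4 h5 with ⟨rfl, h6⟩ | ⟨rfl, h6⟩
      · omega
      · omega
  · exfalso
    have cB : (J + 1) * (v + 1) ≤ L * Q := by omega
    obtain ⟨iB, hiB⟩ := Nat.exists_eq_add_of_le cB
    have hleB : iB + v + 1 ≤ p ^ M := by omega
    have hcB := hB iB hiB hleB
    have hneB : (((p ^ M - 1) * (v + 1)).choose (p ^ M * Q + iB) : F) ≠ 0 := by
      rw [hcB]; exact mul_ne_zero (by simp) (neg_ne_zero.2 hJ0F)
    have hdB := dvd_one _ v L J ℓ Q iB hℓ hiB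
    refine single_contra a ha ℓ _ _ H _ hdB hneB ?_
    intro i' hd hC
    obtain ⟨k, i1, rfl, h1, h2, h3, h4, h5⟩ := split_eq M v q L J ℓ i' hℓ hqL hvq hqle hJ hd hC
    rcases uniq k i1 h1 h2 h3 h4 h5 with ⟨rfl, h6⟩ | ⟨rfl, h6⟩
    · omega
    · omega

set_option maxHeartbeats 1000000 in
theorem case_two {F : Type*} [Field F] [CharP F 2] (a : F) (ha : a ≠ 0) (m M v q L J ℓ T τ w ρ : ℕ)
    (hqm : q = 2 ^ m) (hm : 2 ≤ m) (hqv : q = v + 2)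
    (hℓ : ℓ = 2 ^ M + L) (hqL : ℓ = q * L + 1)
    (hL : L = T * q + 1) (hT : T = q * τ + 1) (hJw : J = T * w) (hR : 2 ^ M = q * ρ)
    (hJ : J + 2 ≤ L) (hw1 : w < q) (hw : w % 2 = 1)
    (H : ∑ i ∈ Finset.range ((2 ^ M - 1) * (v + 1) + 1), (if ℓ ∣ (J + 1) * (v + 1) + i then
      (((2 ^ M - 1) * (v + 1)).choose i : F) * a ^ ((2 ^ M - 1) * (v + 1) - i) else 0) = 0) :
    False := by
  have : Fact (Nat.Prime 2) := ⟨Nat.prime_two⟩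
  have hRpos : 0 < 2 ^ M := pow_pos (by norm_num) _
  have hqle : q ≤ 2 ^ M := Nat.le_of_dvd hRpos ⟨ρ, hR⟩
  have hq4 : q % 4 = 0 := by
    obtain ⟨n, rfl⟩ := Nat.exists_eq_add_of_le hm
    rw [hqm, pow_add]; omega
  have hodd : ∀ n : ℕ, (n : F) ≠ 0 ↔ n % 2 = 1 := by
    intro n
    rw [Ne, CharP.cast_eq_zero_iff F 2]; omega
  have hck : ∀ k, k ≤ v → (((v.choose k : ℕ) : F) ≠ 0 ↔ k % 2 = 0) := by
    intro k hk
    have := choose_neg (F := F) (p := 2) m 1 k (by omega)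
    rw [← hqm, show q - (1 + 1) = v by omega] at this
    rw [this, Nat.choose_one_right, mul_ne_zero_iff, hodd]
    simp
    omega
  have hN : ∀ N : ℕ, ((N.choose v : ℕ) : F) ≠ 0 ↔ (N % q = v ∨ N % q = v + 1) := by
    intro N
    rw [lucas_F (p := 2) m, ← hqm, Nat.mod_eq_of_lt (show v < q by omega),
      Nat.div_eq_of_lt (show v < q by omega)]
    have hlt : N % q < v + 2 := by rw [← hqv]; exact Nat.mod_lt _ (by omega)
    simp only [Nat.choose_zero_right, Nat.cast_one, mul_one]
    constructor
    · intro h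
      have : v ≤ N % q := by
        by_contra hcon
        exact h (by rw [Nat.choose_eq_zero_of_lt (by omega)]; simp)
      omega
    · rintro (h | h)
      · rw [h]; simp
      · rw [h, Nat.choose_succ_self_right, hodd]; omega
  -- congruences
  have hqvZ : (q : ℤ) = v + 2 := by exact_mod_cast hqv
  have hLZ : (L : ℤ) = T * q + 1 := by exact_mod_cast hL
  have hTZ : (T : ℤ) = q * τ + 1 := by exact_mod_cast hT
  have hJZ : (J : ℤ) = T * w := by exact_mod_cast hJw
  have hRZ : (2 : ℤ) ^ M = q * ρ := by exact_mod_cast hR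
  have cong1 : ∀ k i0 : ℕ, L * k = (J + 1) * (v + 1) + i0 →
      ∃ z : ℤ, ((i0 + v : ℕ) : ℤ) + 1 = k + w + q * z := by
    intro k i0 h
    refine ⟨T * k - T * w + τ * w, ?_⟩
    have hz : (L : ℤ) * k = (J + 1) * (v + 1) + i0 := by exact_mod_cast h
    push_cast
    have hv : (v : ℤ) = q - 2 := by linarith
    rw [hLZ, hJZ, hv] at hz
    rw [hv]
    linear_combination -hz + w * hTZ
  have cong2 : ∀ k i0 : ℕ, L * (k + 1) + 2 ^ M = (J + 1) * (v + 1) + i0 →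
      ∃ z : ℤ, ((i0 + v : ℕ) : ℤ) = k + w + q * z := by
    intro k i0 h
    refine ⟨T * (k + 1) - T * w + τ * w + ρ, ?_⟩
    have hz : (L : ℤ) * (k + 1) + 2 ^ M = (J + 1) * (v + 1) + i0 := by exact_mod_cast h
    push_cast
    have hv : (v : ℤ) = q - 2 := by linarith
    rw [hLZ, hJZ, hv, hRZ] at hz
    rw [hv]
    linear_combination -hz + w * hTZ
  have hqpos : (0 : ℤ) < q := by omega
  have small : ∀ (x z : ℤ), x = q * z → -q < x → x < q → x = 0 := by
    intro x z h h1 h2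
    have := Int.eq_zero_of_abs_lt_dvd (m := (q : ℤ)) (x := x) ⟨z, h⟩ (abs_lt.2 ⟨h1, h2⟩)
    exact this
  have par : ∀ x z : ℤ, x = q * z → x % 2 = 0 := by
    intro x z h
    have : (q : ℤ) % 2 = 0 := by omega
    rw [h, Int.mul_emod, this]; simp
  obtain ⟨k₀, hk₀⟩ : ∃ k₀, k₀ + w = v + 1 := ⟨v + 1 - w, by omega⟩
  have uniq : ∀ k i0 : ℕ, k ≤ v → ((v.choose k : ℕ) : F) ≠ 0 → (((i0 + v).choose v : ℕ) : F) ≠ 0 →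
      (L * k = (J + 1) * (v + 1) + i0 ∨ L * (k + 1) + 2 ^ M = (J + 1) * (v + 1) + i0) → k = k₀ := by
    intro k i0 hk h3 h4 h5
    rw [hck k hk] at h3
    rw [hN] at h4
    have hdm : (q : ℤ) * ((i0 + v) / q : ℕ) + ((i0 + v) % q : ℕ) = ((i0 + v : ℕ) : ℤ) := by
      exact_mod_cast Nat.div_add_mod (i0 + v) q
    rcases h5 with h5 | h5
    · obtain ⟨z, hz⟩ := cong1 k i0 h5
      rcases h4 with h4 | h4
      · rw [h4] at hdm
        have := small ((v : ℤ) + 1 - (k + w)) (z - ((i0 + v) / q : ℕ)) (by linarith) (by omega) (by omega)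
        omega
      · rw [h4] at hdm
        have := par (k + w : ℤ) (((i0 + v) / q : ℕ) + 1 - z) (by push_cast at hdm ⊢; push_cast at hz; linarith)
        omega
    · obtain ⟨z, hz⟩ := cong2 k i0 h5
      rcases h4 with h4 | h4
      · rw [h4] at hdm
        have := par ((v : ℤ) - (k + w)) (z - ((i0 + v) / q : ℕ)) (by linarith)
        omega
      · rw [h4] at hdm
        have := small ((v : ℤ) + 1 - (k + w)) (z - ((i0 + v) / q : ℕ)) (by push_cast at hdm ⊢; push_cast at hz; linarith) (by omega) (by omega)
        omega
  have hk₀v : k₀ ≤ v := by omega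
  have hck₀ : ((v.choose k₀ : ℕ) : F) ≠ 0 := (hck k₀ hk₀v).2 (by omega)
  have hT1 : 1 ≤ T := by omega
  have hRL : 2 ^ M = L * (v + 1) + 1 := by
    have h1 : q * L + 1 = 2 ^ M + L := by omega
    rw [hqv] at h1; linarith
  have modq : ∀ (n c : ℕ) (z : ℤ), (n : ℤ) = c + q * z → c < q → n % q = c := by
    intro n c z h hc
    have h1 : (n : ℤ) % q = c := by
      rw [h, Int.add_mul_emod_self_left]
      exact Int.emod_eq_of_lt (by omega) (by omega)
    exact_mod_cast h1
  by_cases hc : 2 * w ≤ v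
  · -- first type
    have hge : (J + 1) * (v + 1) ≤ L * k₀ := by
      obtain ⟨x, rfl⟩ : ∃ x, k₀ = w + 1 + x := ⟨k₀ - (w + 1), by omega⟩
      have hv' : v = w + x + w := by omega
      rw [hJw, hL, hqv, hv']
      obtain ⟨T', rfl⟩ : ∃ T', T = T' + 1 := ⟨T - 1, by omega⟩
      refine Nat.le.intro (k := T' * (3*w+2*w*x+3*x+x*x+2) + (2*w+2*w*x+3*x+x*x+2)) ?_
      ring
    obtain ⟨i0, hi0⟩ := Nat.exists_eq_add_of_le hge
    have hle : i0 + v + 1 ≤ 2 ^ M := by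
      have h1 : L * k₀ ≤ L * (v + 1) := Nat.mul_le_mul_left _ (by omega)
      have h2 : (J + 1) * (v + 1) ≥ v + 1 := Nat.le_mul_of_pos_left _ (by omega)
      omega
    refine single_contra a ha ℓ _ _ H (2 ^ M * k₀ + i0) (dvd_one _ v L J ℓ k₀ i0 hℓ hi0) ?_ ?_
    · rw [coef_eq M v k₀ i0 hle]
      refine mul_ne_zero hck₀ (mul_ne_zero (by simp) ?_)
      rw [hN]
      left
      obtain ⟨z, hz⟩ := cong1 k₀ i0 hi0
      exact modq _ _ z (by have : (k₀ + w : ℤ) = v + 1 := by exact_mod_cast hk₀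
                           linarith) (by omega)
    · intro i' hd hC
      obtain ⟨k, i1, rfl, h1, h2, h3, h4, h5⟩ := split_eq M v q L J ℓ i' hℓ hqL (by omega) hqle hJ hd hC
      obtain rfl := uniq k i1 h2 h3 h4 h5
      rcases h5 with h5 | h5
      · omega
      · exfalso
        have : L * (k + 1) = L * k + L := by ring
        omega
  · have hge : L * (k₀ + 1) ≤ J * (v + 1) := by
      obtain ⟨x, rfl⟩ : ∃ x, w = k₀ + 3 + x := ⟨w - (k₀ + 3), by omega⟩
      have hv' : v = k₀ + x + k₀ + 2 := by omega
      rw [hJw, hL, hqv, hv']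
      obtain ⟨T', rfl⟩ : ∃ T', T = T' + 1 := ⟨T - 1, by omega⟩
      refine Nat.le.intro (k := T' * (3*k₀+5+2*k₀*x+5*x+x*x) + (2*k₀+4+2*k₀*x+5*x+x*x)) ?_
      ring
    have hge2 : (J + 1) * (v + 1) ≤ L * (k₀ + 1) + 2 ^ M := by
      have : (J + 1) * (v + 1) ≤ L * (v + 1) := Nat.mul_le_mul_right _ (by omega)
      omega
    obtain ⟨i0, hi0⟩ := Nat.exists_eq_add_of_le hge2
    have hle : i0 + v + 1 ≤ 2 ^ M := by
      have : (J + 1) * (v + 1) = J * (v + 1) + v + 1 := by ring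
      omega
    refine single_contra a ha ℓ _ _ H (2 ^ M * k₀ + i0) (dvd_two _ v L J ℓ k₀ i0 hℓ hi0) ?_ ?_
    · rw [coef_eq M v k₀ i0 hle]
      refine mul_ne_zero hck₀ (mul_ne_zero (by simp) ?_)
      rw [hN]
      right
      obtain ⟨z, hz⟩ := cong2 k₀ i0 hi0
      exact modq _ _ z (by have : (k₀ + w : ℤ) = v + 1 := by exact_mod_cast hk₀
                           push_cast; push_cast at hz; linarith) (by omega)
    · intro i' hd hC
      obtain ⟨k, i1, rfl, h1, h2, h3, h4, h5⟩ := split_eq M v q L J ℓ i' hℓ hqL (by omega) hqle hJ hd hC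
      obtain rfl := uniq k i1 h2 h3 h4 h5
      rcases h5 with h5 | h5
      · exfalso
        have h6 : L * (k + 1) = L * k + L := by ring
        have : (J + 1) * (v + 1) = J * (v + 1) + v + 1 := by ring
        omega
      · omega

theorem core_contra {F : Type*} [Field F] {p : ℕ} [Fact p.Prime] [CharP F p] (a : F) (ha : a ≠ 0)
    (m M q L ℓ T τ w : ℕ) (hqm : q = p ^ m) (hq2 : q ≠ 2) (hmM : m ≤ M)
    (hℓ : ℓ = p ^ M + L) (hqL : ℓ = q * L + 1)
    (hL : L = T * q + 1) (hT : T = q * τ + 1) (hw0 : 0 < w) (hw : w < q)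
    (hc : (-a) ^ ℓ ≠ 1)
    (H : ∀ v, v + 1 ≤ q → ∑ i ∈ Finset.range ((p ^ M - 1) * (v + 1) + 1),
      (if ℓ ∣ (T * w + 1) * (v + 1) + i then
      (((p ^ M - 1) * (v + 1)).choose i : F) * a ^ ((p ^ M - 1) * (v + 1) - i) else 0) = 0) :
    False := by
  have hpp : p.Prime := Fact.out
  have hp2 := hpp.two_le
  obtain ⟨κ, w0, hw0p, hww⟩ := Nat.exists_eq_pow_mul_and_not_dvd hw0.ne' p hpp.ne_one
  have hκm : κ < m := by
    have h1 : p ^ κ ≤ w := Nat.le_of_dvd hw0 ⟨w0, hww⟩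
    rw [hqm] at hw
    exact (Nat.pow_lt_pow_iff_right hp2).1 (lt_of_le_of_lt h1 hw)
  have hpq : p ∣ q := by rw [hqm]; exact dvd_pow_self p (by omega)
  have hqM : q ∣ p ^ M := by rw [hqm]; exact pow_dvd_pow p hmM
  have hJ : T * w + 2 ≤ L := by
    have h1 : T * (w + 1) ≤ T * q := Nat.mul_le_mul_left _ hw
    have h2 : T * (w + 1) = T * w + T := by ring
    omega
  have hTp : ¬ p ∣ T := by
    intro h
    have h1 : p ∣ q * τ := hpq.mul_right τ
    rw [hT] at h
    exact hpp.one_lt.ne' (Nat.dvd_one.1 ((Nat.dvd_add_right h1).1 h))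
  have hTw : ¬ p ∣ T * w0 := fun h => (hpp.dvd_mul.1 h).elim hTp hw0p
  obtain ⟨ρ, hρ⟩ := hqM
  rcases Nat.eq_zero_or_pos κ with rfl | hκ
  · simp only [pow_zero, one_mul] at hww
    subst hww
    by_cases hp : p = 2
    · subst hp
      have hm2 : 2 ≤ m := by
        by_contra hcon
        have : m = 1 := by omega
        rw [this] at hqm
        exact hq2 hqm
      have h4 : 2 ^ 2 ≤ q := by rw [hqm]; exact Nat.pow_le_pow_right (by norm_num) hm2
      refine case_two a ha m M (q - 2) q L (T * w) ℓ T τ w ρ hqm hm2 (by omega) hℓ hqL hL hT rfl hρ hJ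
        hw (by omega) (H (q - 2) (by omega))
    · refine case_odd a ha M q L (T * w) ℓ hℓ hqL hpq (by omega) ⟨T, ?_⟩ ⟨ρ, hρ⟩ hJ hp hTw (H 1 (by omega))
      rw [hL, Nat.add_sub_cancel]; ring
  · have hQ2 : 2 ≤ p ^ κ := hp2.trans (Nat.le_self_pow hκ.ne' p)
    have hqe : q = p * p ^ κ * p ^ (m - κ - 1) := by
      rw [hqm, ← pow_succ', ← pow_add]; congr 1; omega
    have h2 : 2 * p ^ κ ≤ q := by
      rw [hqe]
      calc 2 * p ^ κ ≤ p * p ^ κ := Nat.mul_le_mul_right _ hp2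
        _ ≤ _ := Nat.le_mul_of_pos_right _ (pow_pos hpp.pos _)
    exact hc (case_big a ha κ M (p ^ κ - 2) (p ^ κ + (p ^ κ - 2)) q (p ^ κ) L (T * w) (T * w0) ℓ T
      (p ^ (m - κ - 1)) ρ rfl hκ.ne' (by omega) rfl hqe (pow_pos hpp.pos _) hℓ hqL hL (by omega) hρ hJ
      (by rw [hww]; ring) hTw (H _ (by omega)))

theorem herm' {F : Type*} [Field F] [Fintype F] (q e ℓ L R r j : ℕ) (hq : 2 ≤ q)
    (hF : Fintype.card F = q ^ e) (hℓ : (q - 1) * ℓ = q ^ e - 1) (a : F) (hr : 1 ≤ r)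
    (hL : (q - 1) * L = R - 1) (hqL : ℓ = q * L + 1) (hL0 : 0 < L) (hj : j = r * L % ℓ)
    (hf : Function.Bijective (fun x : F => x ^ r * (x ^ (q - 1) + a))) (v : ℕ) (hv : v + 1 ≤ q) :
    ∑ i ∈ Finset.range ((R-1)*(v+1)+1), (if ℓ ∣ j * (v+1) + i then
      (((R-1)*(v+1)).choose i : F) * a ^ ((R-1)*(v+1) - i) else 0) = 0 := by
  have h := hermite q e ℓ r hq hF hℓ a hr hf (L * (v + 1)) (by positivity) (by
    have := Nat.mul_le_mul_left L hv
    rw [hqL, mul_comm q L]; omega)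
  rw [← mul_assoc, hL] at h
  have hd : ∀ i, ℓ ∣ r * (L * (v + 1)) + i ↔ ℓ ∣ j * (v + 1) + i := by
    intro i
    rw [← mul_assoc, ← Nat.modEq_zero_iff_dvd, ← Nat.modEq_zero_iff_dvd]
    have : j * (v + 1) + i ≡ r * L * (v + 1) + i [MOD ℓ] := by
      rw [hj]
      exact ((Nat.mod_modEq _ _).mul_right _).add_right _
    exact ⟨fun h => this.trans h, fun h => this.symm.trans h⟩
  simp only [hd] at h
  exact h

theorem j_range {F : Type*} [Field F] {p : ℕ} [Fact p.Prime] [CharP F p] (a : F) (ha : a ≠ 0)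
    (M L ℓ j : ℕ) (hℓ : ℓ = p ^ M + L) (hj : j < ℓ)
    (H : ∑ i ∈ Finset.range ((p ^ M-1)*(0+1)+1), (if ℓ ∣ j * (0+1) + i then
      (((p ^ M-1)*(0+1)).choose i : F) * a ^ ((p ^ M-1)*(0+1) - i) else 0) = 0) :
    1 ≤ j ∧ j ≤ L := by
  have hpp : p.Prime := Fact.out
  have hRpos : 0 < p ^ M := pow_pos hpp.pos _
  by_contra hcon
  obtain ⟨i, hi, hd⟩ : ∃ i, i + 1 ≤ p ^ M ∧ ℓ ∣ j + i := by
    by_cases h : j = 0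
    · exact ⟨0, by omega, by simp [h]⟩
    · refine ⟨ℓ - j, by omega, by rw [Nat.add_sub_cancel' hj.le]⟩
  refine single_contra a ha ℓ _ _ H i (by simpa using hd) ?_ ?_
  · have := coef_eq (F := F) (p := p) M 0 0 i (by omega)
    rw [mul_zero, zero_add i] at this
    rw [this]; simp
  · intro i' hd' hC
    have hi' : i' + 1 ≤ p ^ M := by
      by_contra h
      exact hC (by rw [Nat.choose_eq_zero_of_lt (by omega)]; simp)
    rw [zero_add, mul_one] at hd'
    have h1 : j + i ≡ j + i' [MOD ℓ] :=
      ((Nat.modEq_zero_iff_dvd).2 hd).trans ((Nat.modEq_zero_iff_dvd).2 hd').symm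
    have h2 := Nat.ModEq.add_left_cancel' j h1
    exact (h2.eq_of_lt_of_lt (by omega) (by omega)).symm

theorem conv1 (q L ℓ r : ℕ) (hq : 0 < q) (hL0 : 0 < L) (hqL : ℓ = q * L + 1) (h : r * L % ℓ = 1) :
    r % ℓ = ℓ - q := by
  have hql : q < ℓ := by have := Nat.le_mul_of_pos_right q hL0; omega
  have h1 : r * L ≡ 1 [MOD ℓ] := by
    rw [Nat.ModEq, h, Nat.mod_eq_of_lt (by omega)]
  have h2 : r + q ≡ r + q * (r * L) [MOD ℓ] := by
    have := (h1.symm.mul_left q).add_left r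
    rwa [mul_one] at this
  have h3 : r + q * (r * L) = r * ℓ := by rw [hqL]; ring
  rw [h3] at h2
  have h4 : r + q ≡ (ℓ - q) + q [MOD ℓ] := by
    rw [Nat.sub_add_cancel hql.le]
    exact h2.trans (((Nat.modEq_zero_iff_dvd).2 (dvd_mul_left _ _)).trans
      ((Nat.modEq_zero_iff_dvd).2 dvd_rfl).symm)
  have h5 := Nat.ModEq.add_right_cancel' q h4
  rw [Nat.ModEq, Nat.mod_eq_of_lt (show ℓ - q < ℓ by omega)] at h5
  exact h5

theorem conv2 (q L ℓ r : ℕ) (hq : 0 < q) (hL0 : 0 < L) (hqL : ℓ = q * L + 1) (h : r * L % ℓ = L) :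
    r % ℓ = 1 := by
  have hl : 0 < q * L := Nat.mul_pos hq hL0
  have h1 : r * L ≡ L [MOD ℓ] := by
    conv_rhs => rw [← h]
    exact (Nat.mod_modEq _ _).symm
  have h2 : r + q * L ≡ r + q * (r * L) [MOD ℓ] := (h1.symm.mul_left q).add_left r
  have h3 : r + q * (r * L) = r * ℓ := by rw [hqL]; ring
  rw [h3] at h2
  have h4 : r + q * L ≡ 1 + q * L [MOD ℓ] := by
    rw [show 1 + q * L = ℓ by omega]
    exact h2.trans (((Nat.modEq_zero_iff_dvd).2 (dvd_mul_left _ _)).trans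
      ((Nat.modEq_zero_iff_dvd).2 dvd_rfl).symm)
  have h5 := Nat.ModEq.add_right_cancel' (q * L) h4
  rw [Nat.ModEq, Nat.mod_eq_of_lt (show 1 < ℓ by omega)] at h5
  exact h5

/-- In the case e = 4 : `r ≡ 1 mod (q+1)`. -/
theorem four_mod {F : Type*} [Field F] [Fintype F] {p : ℕ} [Fact p.Prime] [CharP F p]
    (a : F) (ha : a ≠ 0) (m q ℓ r : ℕ) (hqm : q = p ^ m) (hq : 2 ≤ q)
    (hF : Fintype.card F = q ^ 4) (hℓ : (q - 1) * ℓ = q ^ 4 - 1) (hr : 1 ≤ r)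
    (hℓ' : ℓ = (q ^ 2 + 1) * (q + 1))
    (hf : Function.Bijective (fun x : F => x ^ r * (x ^ (q - 1) + a))) : r % (q + 1) = 1 := by
  by_contra hcon
  have H := hermite q 4 ℓ r hq hF hℓ a hr hf (q ^ 2 + 1) (by positivity) (by rw [hℓ']; nlinarith [sq_nonneg q])
  obtain ⟨c, hc, hd⟩ : ∃ c, c + 1 ≤ q ∧ (q + 1) ∣ r + c := by
    have hlt : r % (q + 1) < q + 1 := Nat.mod_lt _ (by omega)
    by_cases h0 : r % (q + 1) = 0
    · exact ⟨0, by omega, by simpa using Nat.dvd_of_mod_eq_zero h0⟩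
    · refine ⟨q + 1 - r % (q + 1), by omega, r / (q + 1) + 1, ?_⟩
      have := Nat.div_add_mod r (q + 1)
      rw [mul_add, mul_one]; omega
  have hs : (q - 1) * (q ^ 2 + 1) < ℓ := by
    rw [hℓ', mul_comm]
    exact Nat.mul_lt_mul_of_pos_left (by omega) (by positivity)
  refine single_contra a ha ℓ _ _ H (c * (q ^ 2 + 1)) ?_ ?_ ?_
  · rw [hℓ', ← add_mul, mul_comm (r + c)]
    exact Nat.mul_dvd_mul_left _ hd
  · have hq2 : q ^ 2 = p ^ (2 * m) := by rw [hqm, ← pow_mul, mul_comm]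
    rw [lucas_F (p := p) (2 * m), ← hq2]
    have hqq : q ≤ q ^ 2 := by nlinarith
    have e1 : (q - 1) * (q ^ 2 + 1) = q ^ 2 * (q - 1) + (q - 1) := by ring
    have e2 : c * (q ^ 2 + 1) = q ^ 2 * c + c := by ring
    rw [e1, e2, Nat.mul_add_mod, Nat.mul_add_mod, Nat.mul_add_div (by omega), Nat.mul_add_div (by omega),
      Nat.mod_eq_of_lt (show q - 1 < q ^ 2 by omega), Nat.mod_eq_of_lt (show c < q ^ 2 by omega),
      Nat.div_eq_of_lt (show q - 1 < q ^ 2 by omega), Nat.div_eq_of_lt (show c < q ^ 2 by omega)]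
    have h := choose_neg (F := F) (p := p) m 0 c (by omega)
    rw [← hqm, zero_add] at h
    rw [add_zero, add_zero, h]
    simp
  · intro i' hd' hC
    have hi' : i' ≤ (q - 1) * (q ^ 2 + 1) := by
      by_contra h
      exact hC (by rw [Nat.choose_eq_zero_of_lt (by omega)]; simp)
    have hci : c * (q ^ 2 + 1) ≤ (q - 1) * (q ^ 2 + 1) := Nat.mul_le_mul_right _ (by omega)
    have hd2 : ℓ ∣ r * (q ^ 2 + 1) + c * (q ^ 2 + 1) := by
      rw [hℓ', ← add_mul, mul_comm (r + c)]
      exact Nat.mul_dvd_mul_left _ hd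
    have h1 : r * (q ^ 2 + 1) + c * (q ^ 2 + 1) ≡ r * (q ^ 2 + 1) + i' [MOD ℓ] :=
      ((Nat.modEq_zero_iff_dvd).2 hd2).trans ((Nat.modEq_zero_iff_dvd).2 hd').symm
    have h2 := Nat.ModEq.add_left_cancel' _ h1
    exact (h2.eq_of_lt_of_lt (by omega) (by omega)).symm

theorem nec_norm {F : Type*} [Field F] [Fintype F] (q e ℓ r : ℕ)
    (hF : Fintype.card F = q ^ e) (hℓ : (q - 1) * ℓ = q ^ e - 1) (hl0 : 0 < ℓ) (a : F) (ha : a ≠ 0)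
    (hr : 1 ≤ r)
    (hf : Function.Bijective (fun x : F => x ^ r * (x ^ (q - 1) + a))) : (-a) ^ ℓ ≠ 1 := by
  classical
  intro hc
  obtain ⟨g, hg⟩ := IsCyclic.exists_ofOrder_eq_natCard (α := Fˣ)
  have hcard : Nat.card Fˣ = (q - 1) * ℓ := by
    rw [Nat.card_eq_fintype_card, Fintype.card_units, hF, hℓ]
  rw [hcard] at hg
  let u : Fˣ := Units.mk0 (-a) (neg_ne_zero.2 ha)
  have hu : u ^ ℓ = 1 := by ext; simpa [u] using hc
  have hgen : ∀ x : Fˣ, x ∈ Submonoid.powers g := by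
    intro x
    have : x ∈ Subgroup.zpowers g := by
      rw [(Subgroup.eq_top_of_card_eq (Subgroup.zpowers g) (by rw [Nat.card_zpowers, hg, hcard]))]
      trivial
    rwa [mem_powers_iff_mem_zpowers]
  obtain ⟨n, hn⟩ := hgen u
  have hn' : g ^ n = u := hn
  have h1 : g ^ (n * ℓ) = 1 := by rw [pow_mul, hn', hu]
  have h2 := orderOf_dvd_of_pow_eq_one h1
  rw [hg] at h2
  obtain ⟨k, hk⟩ := Nat.dvd_of_mul_dvd_mul_right hl0 h2
  have h3 : (g ^ k) ^ (q - 1) = u := by rw [← pow_mul, mul_comm, ← hk, hn']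
  have h4 : ((g ^ k : Fˣ) : F) ^ (q - 1) = -a := by
    have := congrArg (Units.val) h3
    simpa [u] using this
  have h5 : ((g ^ k : Fˣ) : F) = 0 := by
    apply hf.1
    show _ * (((g ^ k : Fˣ) : F) ^ (q - 1) + a) = _
    rw [h4]
    simp [Nat.ne_of_gt hr]
  exact (g ^ k).ne_zero h5

theorem nec_gcd {F : Type*} [Field F] [Fintype F] (q e ℓ r : ℕ) (hq : 2 ≤ q)
    (hF : Fintype.card F = q ^ e) (hℓ : (q - 1) * ℓ = q ^ e - 1) (hl0 : 0 < ℓ) (a : F)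
    (hf : Function.Bijective (fun x : F => x ^ r * (x ^ (q - 1) + a))) :
    Nat.gcd r (q - 1) = 1 := by
  classical
  obtain ⟨g, hg⟩ := IsCyclic.exists_ofOrder_eq_natCard (α := Fˣ)
  have hcard : Nat.card Fˣ = (q - 1) * ℓ := by
    rw [Nat.card_eq_fintype_card, Fintype.card_units, hF, hℓ]
  rw [hcard] at hg
  obtain ⟨d, hd⟩ := Nat.gcd_dvd_right r (q - 1)
  obtain ⟨s, hs⟩ := Nat.gcd_dvd_left r (q - 1)
  set D := Nat.gcd r (q - 1) with hD
  have hz : (g ^ (d * ℓ)) ^ D = 1 := by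
    rw [← pow_mul, show d * ℓ * D = D * d * ℓ by ring, ← hd, ← hg, pow_orderOf_eq_one]
  have e1 : (g ^ (d * ℓ)) ^ r = 1 := by
    conv_lhs => rw [hs, pow_mul, hz, one_pow]
  have e2 : (g ^ (d * ℓ)) ^ (q - 1) = 1 := by
    rw [hd, pow_mul, hz, one_pow]
  have e1' : ((g ^ (d * ℓ) : Fˣ) : F) ^ r = 1 := by
    rw [← Units.val_pow_eq_pow_val, e1, Units.val_one]
  have e2' : ((g ^ (d * ℓ) : Fˣ) : F) ^ (q - 1) = 1 := by
    rw [← Units.val_pow_eq_pow_val, e2, Units.val_one]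
  have h5 : ((g ^ (d * ℓ) : Fˣ) : F) = 1 := by
    apply hf.1
    show ((g ^ (d * ℓ) : Fˣ) : F) ^ r * (((g ^ (d * ℓ) : Fˣ) : F) ^ (q - 1) + a) = _
    rw [e1', e2']; simp
  have h6 : g ^ (d * ℓ) = 1 := by ext; simpa using h5
  have h7 := orderOf_dvd_of_pow_eq_one h6
  rw [hg] at h7
  have h8 := Nat.dvd_of_mul_dvd_mul_right hl0 h7
  have hd0 : 0 < d := by
    rcases Nat.eq_zero_or_pos d with h | h
    · rw [h] at hd; omega
    · exact h
  have h9 := Nat.le_of_dvd hd0 h8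
  rw [hd] at h9
  have hD0 : 0 < D := by
    rcases Nat.eq_zero_or_pos D with h | h
    · rw [h] at hd; omega
    · exact h
  nlinarith

theorem suff_fin {F : Type*} [Field F] (q r : ℕ) (a : F) (hgcd : Nat.gcd r (q - 1) = 1)
    (x y lam : F) (hx : x = lam * y) (hl : lam ^ (q - 1) = 1) (hy : y ≠ 0)
    (hy2 : y ^ (q - 1) + a ≠ 0)
    (h : x ^ r * (x ^ (q - 1) + a) = y ^ r * (y ^ (q - 1) + a)) : x = y := by
  rw [hx, mul_pow, mul_pow, hl, one_mul] at h
  have h0 : y ^ r * (y ^ (q - 1) + a) ≠ 0 := mul_ne_zero (pow_ne_zero _ hy) hy2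
  have h1 : lam ^ r = 1 := by
    apply mul_right_cancel₀ h0
    rw [one_mul, ← mul_assoc, h]
  have h2 := Nat.dvd_gcd (orderOf_dvd_of_pow_eq_one h1) (orderOf_dvd_of_pow_eq_one hl)
  rw [hgcd, Nat.dvd_one, orderOf_eq_one_iff] at h2
  rw [hx, h2, one_mul]

theorem suff {F : Type*} [Field F] [Fintype F] {p : ℕ} [Fact p.Prime] [CharP F p]
    (m q e ℓ r : ℕ) (hqm : q = p ^ m) (hq : 2 ≤ q) (hql : q < ℓ)
    (hF : Fintype.card F = q ^ e) (hℓ : (q - 1) * ℓ = q ^ e - 1) (a : F) (hr : 1 ≤ r)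
    (hc : (-a) ^ ℓ ≠ 1) (hgcd : Nat.gcd r (q - 1) = 1) (hmod : r % ℓ = 1 ∨ r % ℓ = ℓ - q) :
    Function.Bijective (fun x : F => x ^ r * (x ^ (q - 1) + a)) := by
  have hN : ∀ x : F, x ≠ 0 → (x ^ ℓ) ^ (q - 1) = 1 := by
    intro x hx
    rw [← pow_mul, mul_comm, hℓ, ← hF]
    exact FiniteField.pow_card_sub_one_eq_one x hx
  have hA : ∀ x : F, x ≠ 0 → x ^ (q - 1) + a ≠ 0 := by
    intro x hx h
    apply hc
    rw [← eq_neg_of_add_eq_zero_left h, ← pow_mul, mul_comm, pow_mul]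
    exact hN x hx
  have hadd : ∀ x y : F, (x - y) ^ q = x ^ q - y ^ q := by
    intro x y
    rw [hqm]; exact sub_pow_char_pow ..
  have hpq : ∀ x : F, x ^ q = x ^ (q - 1) * x := by
    intro x
    rw [← pow_succ, Nat.sub_add_cancel (by omega)]
  rw [← Finite.injective_iff_bijective]
  intro x y hxy
  have h : x ^ r * (x ^ (q - 1) + a) = y ^ r * (y ^ (q - 1) + a) := hxy
  by_cases hx : x = 0
  · by_cases hy : y = 0
    · rw [hx, hy]
    · exfalso
      rw [hx, zero_pow (by omega), zero_mul] at h
      exact mul_ne_zero (pow_ne_zero _ hy) (hA y hy) h.symm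
  by_cases hy : y = 0
  · exfalso
    rw [hy, zero_pow (by omega : r ≠ 0), zero_mul] at h
    exact mul_ne_zero (pow_ne_zero _ hx) (hA x hx) h
  have hxl : x ^ ℓ ≠ 0 := pow_ne_zero _ hx
  have hyl : y ^ ℓ ≠ 0 := pow_ne_zero _ hy
  rcases hmod with h1 | h1
  · obtain ⟨k, hk⟩ : ∃ k, r = ℓ * k + 1 := ⟨r / ℓ, by
      have := Nat.div_add_mod r ℓ; omega⟩
    have hlam : ((y ^ ℓ) ^ k / (x ^ ℓ) ^ k) ^ (q - 1) = 1 := by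
      rw [div_pow, pow_right_comm, pow_right_comm (x ^ ℓ), hN x hx, hN y hy]; simp
    refine suff_fin q r a hgcd x y ((y ^ ℓ) ^ k / (x ^ ℓ) ^ k) ?_ hlam hy (hA y hy) h
    set lam := (y ^ ℓ) ^ k / (x ^ ℓ) ^ k with hlamdef
    have e0 : (y ^ ℓ) ^ k = lam * (x ^ ℓ) ^ k := by
      rw [hlamdef]; field_simp
    have e1 : x * (x ^ (q - 1) + a) = lam * (y * (y ^ (q - 1) + a)) := by
      have hne : (x ^ ℓ) ^ k ≠ 0 := pow_ne_zero _ hxl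
      apply mul_left_cancel₀ hne
      have h' := h
      rw [hk, pow_succ, pow_succ, pow_mul, pow_mul, e0] at h'
      linear_combination h'
    by_contra hne
    have hne' : x - lam * y ≠ 0 := sub_ne_zero.2 hne
    apply hA _ hne'
    apply mul_right_cancel₀ hne'
    rw [zero_mul, add_mul, ← hpq, hadd, mul_pow, hpq lam, hlam, hpq x, hpq y]
    linear_combination e1
  · obtain ⟨k, hk⟩ : ∃ k, r + q = ℓ * k := ⟨r / ℓ + 1, by
      have := Nat.div_add_mod r ℓ; rw [mul_add, mul_one]; omega⟩
    have hlam : ((x ^ ℓ) ^ k / (y ^ ℓ) ^ k) ^ (q - 1) = 1 := by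
      rw [div_pow, pow_right_comm, pow_right_comm (y ^ ℓ), hN x hx, hN y hy]; simp
    refine suff_fin q r a hgcd x y ((x ^ ℓ) ^ k / (y ^ ℓ) ^ k) ?_ hlam hy (hA y hy) h
    set lam := (x ^ ℓ) ^ k / (y ^ ℓ) ^ k with hlamdef
    have hlam0 : lam ≠ 0 := by
      rw [hlamdef]; exact div_ne_zero (pow_ne_zero _ hxl) (pow_ne_zero _ hyl)
    have e0 : (x ^ ℓ) ^ k = lam * (y ^ ℓ) ^ k := by
      rw [hlamdef]; field_simp
    have e1 : lam * y ^ q * (x ^ (q - 1) + a) = x ^ q * (y ^ (q - 1) + a) := by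
      have hne : (y ^ ℓ) ^ k ≠ 0 := pow_ne_zero _ hyl
      apply mul_left_cancel₀ hne
      have ex : (x ^ ℓ) ^ k = x ^ r * x ^ q := by rw [← pow_mul, ← hk, pow_add]
      have ey : (y ^ ℓ) ^ k = y ^ r * y ^ q := by rw [← pow_mul, ← hk, pow_add]
      have : lam * (y ^ ℓ) ^ k * y ^ q * (x ^ (q - 1) + a) =
          (y ^ ℓ) ^ k * (x ^ q * (y ^ (q - 1) + a)) := by
        rw [← e0, ex, ey]
        linear_combination x ^ q * y ^ q * h
      linear_combination this
    by_contra hne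
    -- with `X = 1/x`, `Z = lam/y`... cleared of denominators
    have hne' : lam * y - x ≠ 0 := sub_ne_zero.2 (Ne.symm hne)
    have hW : x * y / (lam * y - x) ≠ 0 := div_ne_zero (mul_ne_zero hx hy) hne'
    apply hA _ hW
    have hlq : lam ^ q = lam := by rw [hpq, hlam, one_mul]
    have e2 : (lam * y - x) ^ (q - 1) * (lam * y - x) = lam * y ^ q - x ^ q := by
      rw [← hpq, hadd, mul_pow, hlq]
    have hP : (lam * y - x) ^ (q - 1) ≠ 0 := pow_ne_zero _ hne'
    rw [div_pow, div_add' _ _ _ hP, div_eq_zero_iff]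
    left
    apply mul_right_cancel₀ hne'
    rw [zero_mul, add_mul, mul_assoc a, e2, mul_pow]
    rw [hpq x, hpq y] at e1 ⊢
    linear_combination e1

theorem nec_fin {F : Type*} [Field F] [Fintype F] {p : ℕ} [Fact p.Prime] [CharP F p]
    (a : F) (ha : a ≠ 0) (m M q e L ℓ r T τ w : ℕ) (hqm : q = p ^ m) (hq : 2 ≤ q) (hq2 : q ≠ 2)
    (hmM : m ≤ M) (hF : Fintype.card F = q ^ e) (hℓ' : (q - 1) * ℓ = q ^ e - 1) (hr : 1 ≤ r)
    (hℓ : ℓ = p ^ M + L) (hqL : ℓ = q * L + 1) (hLR : (q - 1) * L = p ^ M - 1)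
    (hL : L = T * q + 1) (hT : T = q * τ + 1) (hw : w ≤ q) (hj : T * w + 1 = r * L % ℓ)
    (hc : (-a) ^ ℓ ≠ 1)
    (hf : Function.Bijective (fun x : F => x ^ r * (x ^ (q - 1) + a))) :
    r % ℓ = 1 ∨ r % ℓ = ℓ - q := by
  have hL0 : 0 < L := by omega
  by_cases h0 : w = 0
  · right
    rw [h0] at hj
    exact conv1 q L ℓ r (by omega) hL0 hqL (by omega)
  by_cases h1 : w = q
  · left
    rw [h1] at hj
    exact conv2 q L ℓ r (by omega) hL0 hqL (by rw [← hj, hL])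
  · exfalso
    exact core_contra a ha m M q L ℓ T τ w hqm hq2 hmM hℓ hqL hL hT (by omega) (by omega) hc
      (fun v hv => herm' q e ℓ L (p ^ M) r _ hq hF hℓ' a hr hLR hqL hL0 hj hf v hv)

theorem nec_mod {F : Type*} [Field F] [Fintype F] {p : ℕ} [Fact p.Prime] [CharP F p]
    (a : F) (ha : a ≠ 0) (m q e ℓ r : ℕ) (hqm : q = p ^ m) (hq : 2 ≤ q) (hq2 : q ≠ 2)
    (he : e = 2 ∨ e = 3 ∨ e = 4)
    (hF : Fintype.card F = q ^ e) (hℓ' : (q - 1) * ℓ = q ^ e - 1) (hr : 1 ≤ r)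
    (hℓ : ℓ = ∑ i ∈ Finset.range e, q ^ i)
    (hc : (-a) ^ ℓ ≠ 1)
    (hf : Function.Bijective (fun x : F => x ^ r * (x ^ (q - 1) + a))) :
    r % ℓ = 1 ∨ r % ℓ = ℓ - q := by
  rcases he with rfl | rfl | rfl
  · have hl : ℓ = q + 1 := by rw [hℓ]; simp [Finset.sum_range_succ]; omega
    have hLR : (q - 1) * 1 = p ^ m - 1 := by rw [← hqm]; omega
    have hj := j_range (p := p) a ha m 1 ℓ (r * 1 % ℓ) (by rw [← hqm]; exact hl)
      (Nat.mod_lt _ (by omega))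
      (herm' q 2 ℓ 1 (p ^ m) r _ hq hF hℓ' a hr hLR (by omega) (by omega) rfl hf 0 (by omega))
    right
    exact conv1 q 1 ℓ r (by omega) (by omega) (by omega) (by omega)
  · have hl : ℓ = q ^ 2 + q + 1 := by rw [hℓ]; simp [Finset.sum_range_succ]; ring
    have hR : p ^ (m * 2) = q ^ 2 := by rw [hqm, ← pow_mul]
    have hLR : (q - 1) * (q + 1) = p ^ (m * 2) - 1 := by
      rw [hR]
      obtain ⟨n, rfl⟩ : ∃ n, q = n + 1 := ⟨q - 1, by omega⟩
      rw [Nat.add_sub_cancel]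
      apply Nat.eq_sub_of_add_eq; ring
    have hqL : ℓ = q * (q + 1) + 1 := by rw [hl]; ring
    have hℓR : ℓ = p ^ (m * 2) + (q + 1) := by rw [hR, hl]; ring
    have hj := j_range (p := p) a ha (m * 2) (q + 1) ℓ (r * (q + 1) % ℓ) hℓR
      (Nat.mod_lt _ (by omega))
      (herm' q 3 ℓ (q + 1) (p ^ (m * 2)) r _ hq hF hℓ' a hr hLR hqL (by omega) rfl hf 0 (by omega))
    exact nec_fin a ha m (m * 2) q 3 (q + 1) ℓ r 1 0 (r * (q + 1) % ℓ - 1) hqm hq hq2 (by omega)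
      hF hℓ' hr hℓR hqL hLR (by omega) (by omega) (by omega) (by omega) hc hf
  · have hl : ℓ = q ^ 3 + q ^ 2 + q + 1 := by rw [hℓ]; simp [Finset.sum_range_succ]; ring
    have hR : p ^ (m * 3) = q ^ 3 := by rw [hqm, ← pow_mul]
    have hLR : (q - 1) * (q ^ 2 + q + 1) = p ^ (m * 3) - 1 := by
      rw [hR]
      obtain ⟨n, rfl⟩ : ∃ n, q = n + 1 := ⟨q - 1, by omega⟩
      rw [Nat.add_sub_cancel]
      apply Nat.eq_sub_of_add_eq; ring
    have hqL : ℓ = q * (q ^ 2 + q + 1) + 1 := by rw [hl]; ring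
    have hℓR : ℓ = p ^ (m * 3) + (q ^ 2 + q + 1) := by rw [hR, hl]; ring
    have hℓ4 : ℓ = (q ^ 2 + 1) * (q + 1) := by rw [hl]; ring
    have hj := j_range (p := p) a ha (m * 3) (q ^ 2 + q + 1) ℓ (r * (q ^ 2 + q + 1) % ℓ) hℓR
      (Nat.mod_lt _ (by omega))
      (herm' q 4 ℓ (q ^ 2 + q + 1) (p ^ (m * 3)) r _ hq hF hℓ' a hr hLR hqL (by omega) rfl hf 0
        (by omega))
    have h4 := four_mod a ha m q ℓ r hqm hq hF hℓ' hr hℓ4 hf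
    have hjm : r * (q ^ 2 + q + 1) % ℓ % (q + 1) = 1 := by
      rw [Nat.mod_mod_of_dvd _ ⟨q ^ 2 + 1, by rw [hℓ4, mul_comm]⟩, Nat.mul_mod, h4,
        show q ^ 2 + q + 1 = 1 + (q + 1) * q by ring, Nat.add_mul_mod_self_left]
      simp
      omega
    have hdm := Nat.div_add_mod (r * (q ^ 2 + q + 1) % ℓ) (q + 1)
    rw [hjm] at hdm
    refine nec_fin a ha m (m * 3) q 4 (q ^ 2 + q + 1) ℓ r (q + 1) 1
      (r * (q ^ 2 + q + 1) % ℓ / (q + 1)) hqm hq hq2 (by omega)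
      hF hℓ' hr hℓR hqL hLR (by ring) (by ring) ?_ hdm hc hf
    by_contra hcon
    have : (q + 1) * (q + 1) ≤ (q + 1) * (r * (q ^ 2 + q + 1) % ℓ / (q + 1)) :=
      Nat.mul_le_mul_left _ (by omega)
    nlinarith


/-- For `e ∈ {2, 3, 4}`, `f(x) = x^r (x^{q-1} + a)` permutes `F_{q^e}` if and only if
`(-a)^ℓ ≠ 1`, `gcd(r, q-1) = 1`, and `r mod ℓ ∈ {1, ℓ - q}`, where
`ℓ = q^{e-1} + ⋯ + q + 1`. -/
theorem stmt_16 (p m q e : ℕ) (hp : p.Prime) (hm : 0 < m) (hq : q = p ^ m)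
    (he : e = 2 ∨ e = 3 ∨ e = 4)
    {F : Type*} [Field F] [Fintype F] (hF : Fintype.card F = q ^ e)
    (a : F) (ha : a ≠ 0) (r : ℕ) (hr : 1 ≤ r)
    (ℓ : ℕ) (hℓ : ℓ = ∑ i ∈ Finset.range e, q ^ i) :
    Function.Bijective (fun x : F => x ^ r * (x ^ (q - 1) + a)) ↔
      ((-a) ^ ℓ ≠ 1 ∧ Nat.gcd r (q - 1) = 1 ∧ (r % ℓ = 1 ∨ r % ℓ = ℓ - q)) := by
  have hp1 := hp.two_le
  have hq2 : 2 ≤ q := by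
    rw [hq]
    calc 2 ≤ p := hp1
      _ = p ^ 1 := (pow_one p).symm
      _ ≤ p ^ m := Nat.pow_le_pow_right hp.pos hm
  haveI : Fact p.Prime := ⟨hp⟩
  haveI : CharP F p := by
    obtain ⟨p', hchar⟩ := CharP.exists F
    obtain ⟨n, hp', hcard⟩ := FiniteField.card F p'
    have h1 : p' ∣ p ^ (m * e) := by
      rw [pow_mul, ← hq, ← hF, hcard]
      exact dvd_pow_self _ n.ne_zero
    have h2 := (Nat.prime_dvd_prime_iff_eq hp' hp).1 (hp'.dvd_of_dvd_pow h1)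
    rw [← h2]; exact hchar
  have hℓ' : (q - 1) * ℓ = q ^ e - 1 := by
    rw [hℓ, mul_comm]
    apply Nat.eq_sub_of_add_eq
    have := Nat.geomSum_eq hq2 e
    have hd : (q - 1) ∣ q ^ e - 1 := by simpa using Nat.sub_dvd_pow_sub_pow q 1 e
    rw [this, Nat.div_mul_cancel hd, Nat.sub_add_cancel (Nat.one_le_pow _ _ (by omega))]
  have hql : q < ℓ := by
    rw [hℓ]
    rcases he with rfl | rfl | rfl <;> simp only [Finset.sum_range_succ, Finset.sum_range_zero, pow_zero, pow_one] <;>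
      nlinarith [Nat.zero_le (q ^ 2), Nat.zero_le (q ^ 3)]
  constructor
  · intro hf
    have hc := nec_norm q e ℓ r hF hℓ' (by omega) a ha hr hf
    refine ⟨hc, nec_gcd q e ℓ r hq2 hF hℓ' (by omega) a hf, ?_⟩
    refine nec_mod a ha m q e ℓ r hq hq2 ?_ he hF hℓ' hr hℓ hc hf
    intro h2
    apply hc
    have : ℓ = Fintype.card F - 1 := by rw [hF, ← hℓ', h2]; simp
    rw [this]
    exact FiniteField.pow_card_sub_one_eq_one _ (neg_ne_zero.2 ha)
  · rintro ⟨hc, hg, hmod⟩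
    exact suff m q e ℓ r hq hq2 hql hF hℓ' a hr hc hg hmod
end
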